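/- arXiv:1903.03549 — 2 statements merged into one kernel-verified Lean document; each statement's English description precedes it below -/
import Mathlib

section
/- Let G be a finite group, p a prime and n ≥ 0. The inclusions of posets A_p(G)^n ↪ A_p(G)^{n+1} and S_p(G)^n ↪ S_p(G)^{n+1} induce n-equivalences between the geometric realizations of the corresponding order complexes. In particular, the inclusions A_p(G)^2 ↪ A_p(G) and S_p(G)^2 ↪ S_p(G) induce isomorphisms of fundamental groups at every basepoint. -/
open Function

/-- The geometric realization of the order complex of the subposet `S` of `X`,
realized as a subspace of `X → ℝ`: convex combinations supported on finite
nonempty chains contained in `S`. -/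
def geomRealOn {X : Type*} [Preorder X] (S : Set X) : Set (X → ℝ) :=
  {f | (∀ x, 0 ≤ f x) ∧ Function.support f ⊆ S ∧ IsChain (· ≤ ·) (Function.support f) ∧
    ∃ s : Finset X, Function.support f ⊆ ↑s ∧ ∑ x ∈ s, f x = 1}

/-- A group is elementary abelian for the prime `p` if it is abelian and
every element has order dividing `p`. -/
def IsElementaryAbelian (p : ℕ) (G : Type*) [Group G] : Prop :=
  (∀ a b : G, a * b = b * a) ∧ ∀ a : G, a ^ p = 1

/-- The Quillen poset `A_p(G)`: nontrivial elementary abelian `p`-subgroups of `G`. -/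
def apSet (p : ℕ) (G : Type*) [Group G] : Set (Subgroup G) :=
  {H | H ≠ ⊥ ∧ IsElementaryAbelian p ↥H}

/-- The poset `S_p(G)` of nontrivial `p`-subgroups of `G`. -/
def spSet (p : ℕ) (G : Type*) [Group G] : Set (Subgroup G) :=
  {H | H ≠ ⊥ ∧ IsPGroup p ↥H}

/-- The truncated poset `A_p(G)ⁿ = {A ∈ A_p(G) : |A| ≤ p^(n+1)}`. -/
def apSetN (p : ℕ) (G : Type*) [Group G] (n : ℕ) : Set (Subgroup G) :=
  {H | H ∈ apSet p G ∧ Nat.card ↥H ≤ p ^ (n + 1)}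

/-- The truncated poset `S_p(G)ⁿ = {P ∈ S_p(G) : |P| ≤ p^(n+1)}`. -/
def spSetN (p : ℕ) (G : Type*) [Group G] (n : ℕ) : Set (Subgroup G) :=
  {H | H ∈ spSet p G ∧ Nat.card ↥H ≤ p ^ (n + 1)}

theorem geomRealOn_mono {X : Type*} [Preorder X] {S T : Set X} (h : S ⊆ T) :
    geomRealOn S ⊆ geomRealOn T :=
  fun _ hf => ⟨hf.1, hf.2.1.trans h, hf.2.2⟩

/-- The continuous inclusion of geometric realizations induced by an inclusion of
subposets. -/
def geomRealIncl {X : Type*} [Preorder X] {S T : Set X} (h : S ⊆ T) :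
    C(↥(geomRealOn S), ↥(geomRealOn T)) :=
  ⟨fun f => ⟨f.1, geomRealOn_mono h f.2⟩, Continuous.subtype_mk continuous_subtype_val _⟩

/-- The map on generalized loops induced by composition with a continuous map. -/
noncomputable def genLoopMap {A B : Type*} [TopologicalSpace A] [TopologicalSpace B]
    (N : Type*) (f : C(A, B)) (a : A) (p : ↥(GenLoop N A a)) : ↥(GenLoop N B (f a)) :=
  ⟨f.comp p.1, fun y hy => by
    simp only [ContinuousMap.comp_apply]
    exact congrArg f (p.2 y hy)⟩

/-- The map induced by a continuous map `f` on homotopy groups (with cube shape `N`),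
given by postcomposition with `f`. -/
noncomputable def inducedPiMap {A B : Type*} [TopologicalSpace A] [TopologicalSpace B]
    (N : Type*) (f : C(A, B)) (a : A) :
    HomotopyGroup N A a → HomotopyGroup N B (f a) :=
  Quotient.map (genLoopMap N f a)
    (fun _ _ h => h.map fun F => F.compContinuousMap f)

/-- A continuous map is an `n`-equivalence if, at every basepoint, it induces a
bijection on the homotopy groups `π_i` for all `i < n` and a surjection on `π_n`. -/
def IsNEquivalence {A B : Type*} [TopologicalSpace A] [TopologicalSpace B]
    (f : C(A, B)) (n : ℕ) : Prop :=
  ∀ a : A, (∀ i < n, Function.Bijective (inducedPiMap (Fin i) f a)) ∧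
    Function.Surjective (inducedPiMap (Fin n) f a)

theorem apSetN_subset_succ (p : ℕ) (G : Type*) [Group G] (n : ℕ) (hp : 1 ≤ p) :
    apSetN p G n ⊆ apSetN p G (n + 1) :=
  fun _ h => ⟨h.1, h.2.trans (Nat.pow_le_pow_right hp (by omega))⟩

theorem spSetN_subset_succ (p : ℕ) (G : Type*) [Group G] (n : ℕ) (hp : 1 ≤ p) :
    spSetN p G n ⊆ spSetN p G (n + 1) :=
  fun _ h => ⟨h.1, h.2.trans (Nat.pow_le_pow_right hp (by omega))⟩

theorem apSetN_subset (p : ℕ) (G : Type*) [Group G] (n : ℕ) :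
    apSetN p G n ⊆ apSet p G :=
  fun _ h => h.1

theorem spSetN_subset (p : ℕ) (G : Type*) [Group G] (n : ℕ) :
    spSetN p G n ⊆ spSet p G :=
  fun _ h => h.1

/-- A cell of the integer grid in `κ → ℝ`: in each direction either a point `n`
(encoded by `(n, false)`) or an interval `[n, n + 1]` (encoded by `(n, true)`). -/
abbrev GridCell (κ : Type*) := κ → ℤ × Bool

namespace GridCell

variable {κ : Type*}

/-- The closed cell in `κ → ℝ`. -/
def carrier (σ : GridCell κ) : Set (κ → ℝ) :=
  {x | ∀ i, ((σ i).1 : ℝ) ≤ x i ∧ x i ≤ (σ i).1 + if (σ i).2 then 1 else 0}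

/-- The relative boundary of a cell. -/
def bd (σ : GridCell κ) : Set (κ → ℝ) :=
  {x | x ∈ σ.carrier ∧ ∃ i, (σ i).2 = true ∧ (x i = (σ i).1 ∨ x i = (σ i).1 + 1)}

/-- The dimension of a cell. -/
def dim [Fintype κ] (σ : GridCell κ) : ℕ := Fintype.card {i // (σ i).2 = true}

/-- `ρ` is a codimension one face of `σ`. -/
def IsFacet (ρ σ : GridCell κ) : Prop :=
  ∃ i, (σ i).2 = true ∧ (ρ i = ((σ i).1, false) ∨ ρ i = ((σ i).1 + 1, false)) ∧
    ∀ j, j ≠ i → ρ j = σ j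

theorem isClosed_carrier (σ : GridCell κ) : IsClosed σ.carrier := by
  have : σ.carrier =
      ⋂ i, {x : κ → ℝ | ((σ i).1 : ℝ) ≤ x i ∧ x i ≤ (σ i).1 + if (σ i).2 then 1 else 0} := by
    ext x; simp [carrier]
  rw [this]
  exact isClosed_iInter fun i => (isClosed_le continuous_const (continuous_apply i)).inter
    (isClosed_le (continuous_apply i) continuous_const)

theorem IsFacet.carrier_subset {ρ σ : GridCell κ} (h : IsFacet ρ σ) :
    ρ.carrier ⊆ σ.carrier := by
  obtain ⟨i, hi, hρ, hj⟩ := h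
  intro x hx j
  have hxj := hx j
  by_cases hji : j = i
  · subst hji
    rcases hρ with hρ | hρ <;> rw [hρ] at hxj <;> simp [hi] at hxj ⊢ <;> constructor <;> linarith
  · rwa [hj j hji] at hxj

theorem exists_isFacet_of_mem_bd {σ : GridCell κ} {x : κ → ℝ} (hx : x ∈ σ.bd) :
    ∃ ρ, IsFacet ρ σ ∧ x ∈ ρ.carrier := by
  classical
  obtain ⟨hxσ, i, hi, h⟩ := hx
  rcases h with h | h
  · refine ⟨Function.update σ i ((σ i).1, false), ⟨i, hi, by simp, fun j hj => by simp [hj]⟩, ?_⟩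
    intro j
    by_cases hj : j = i
    · subst hj; simp [h]
    · simpa [hj] using hxσ j
  · refine ⟨Function.update σ i ((σ i).1 + 1, false),
      ⟨i, hi, by simp, fun j hj => by simp [hj]⟩, ?_⟩
    intro j
    by_cases hj : j = i
    · subst hj; simp [h]
    · simpa [hj] using hxσ j

theorem IsFacet.dim_lt [Fintype κ] {ρ σ : GridCell κ} (h : IsFacet ρ σ) : ρ.dim < σ.dim := by
  obtain ⟨i, hi, hρ, hj⟩ := h
  have hρi : (ρ i).2 = false := by rcases hρ with h | h <;> simp [h]
  unfold dim
  refine Fintype.card_lt_of_injective_of_notMem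
    (fun j : {j // (ρ j).2 = true} => (⟨j.1, ?_⟩ : {j // (σ j).2 = true})) ?_ (b := ⟨i, hi⟩) ?_
  · have := j.2
    by_cases hji : j.1 = i
    · rw [hji] at this; simp [hρi] at this
    · rwa [hj _ hji] at this
  · intro a b hab
    exact Subtype.ext (by simpa using hab)
  · rintro ⟨j, hj'⟩
    have := j.2
    simp only [Subtype.mk.injEq] at hj'
    rw [hj', hρi] at this
    simp at this

theorem mem_bd_of_mem_of_mem [Fintype κ] {σ τ : GridCell κ} {x : κ → ℝ} (hσ : x ∈ σ.carrier)
    (hτ : x ∈ τ.carrier) (hne : τ ≠ σ) (hdim : τ.dim ≤ σ.dim) : x ∈ σ.bd := by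
  refine ⟨hσ, ?_⟩
  by_contra! hcon
  have key : ∀ i, (σ i).2 = true → τ i = σ i := by
    intro i hi
    have h1 := hσ i
    have h2 := hτ i
    have h3 := hcon i hi
    simp only [hi, if_true] at h1
    have l1 : ((σ i).1 : ℝ) < x i := lt_of_le_of_ne h1.1 (Ne.symm h3.1)
    have l2 : x i < (σ i).1 + 1 := lt_of_le_of_ne h1.2 h3.2
    have h4 : (τ i).1 < (σ i).1 + 1 := by exact_mod_cast h2.1.trans_lt l2
    rcases hb : (τ i).2 with _ | _
    · simp only [hb] at h2
      have : (σ i).1 < (τ i).1 := by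
        have : ((σ i).1 : ℝ) < (τ i).1 := by have := h2.2; simp at this; linarith
        exact_mod_cast this
      omega
    · simp only [hb, if_true] at h2
      have h5 : (σ i).1 < (τ i).1 + 1 := by exact_mod_cast l1.trans_le h2.2
      exact Prod.ext (by omega) (by rw [hb, hi])
  have hinj : Function.Injective
      (fun j : {j // (σ j).2 = true} => (⟨j.1, by rw [key _ j.2, j.2]⟩ : {j // (τ j).2 = true})) :=
    fun a b hab => Subtype.ext (by simpa using hab)
  have hbij := (Fintype.bijective_iff_injective_and_card _).2
    ⟨hinj, le_antisymm (Fintype.card_le_of_injective _ hinj) hdim⟩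
  refine hne (funext fun i => ?_)
  rcases hi : (σ i).2 with _ | _
  · rcases hb : (τ i).2 with _ | _
    · have h1 := hσ i
      have h2 := hτ i
      simp only [hi, hb] at h1 h2
      simp only [Bool.false_eq_true, if_false, add_zero] at h1 h2
      have : ((τ i).1 : ℝ) = (σ i).1 := by linarith
      exact Prod.ext (by exact_mod_cast this) (by rw [hb, hi])
    · obtain ⟨j, hj⟩ := hbij.2 ⟨i, hb⟩
      have := j.2
      simp only [Subtype.mk.injEq] at hj
      rw [hj, hi] at this
      simp at this
  · exact key i hi

/-- Maps on a finite complex of grid cells can be built cell by cell. -/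
theorem exists_cellwise_extension [Fintype κ] {E : Type*} [TopologicalSpace E] [Nonempty E]
    (K : Finset (GridCell κ)) (Q : GridCell κ → ((κ → ℝ) → E) → Prop)
    (hcongr : ∀ σ g g', Set.EqOn g g' σ.carrier → Q σ g → Q σ g')
    (hK : ∀ σ ∈ K, ∀ ρ, IsFacet ρ σ → ρ ∈ K)
    (hext : ∀ σ ∈ K, ∀ g, ContinuousOn g σ.bd → (∀ ρ, IsFacet ρ σ → Q ρ g) →
      ∃ g', ContinuousOn g' σ.carrier ∧ Set.EqOn g' g σ.bd ∧ Q σ g') :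
    ∃ g, ContinuousOn g (⋃ σ ∈ K, σ.carrier) ∧ ∀ σ ∈ K, Q σ g := by
  classical
  induction K using Finset.induction_on_max_value (fun σ : GridCell κ => σ.dim) with
  | empty => exact ⟨fun _ => Classical.arbitrary E, by simp, by simp⟩
  | insert a s ha hmax ih =>
    have hs : ∀ σ ∈ s, ∀ ρ, IsFacet ρ σ → ρ ∈ s := by
      intro σ hσ ρ hρ
      rcases Finset.mem_insert.1 (hK σ (Finset.mem_insert_of_mem hσ) ρ hρ) with h | h
      · have := hmax σ hσ
        have := hρ.dim_lt
        subst h; omega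
      · exact h
    obtain ⟨g, hgc, hgQ⟩ := ih hs fun σ hσ => hext σ (Finset.mem_insert_of_mem hσ)
    have hfac : ∀ ρ, IsFacet ρ a → ρ ∈ s := by
      intro ρ hρ
      rcases Finset.mem_insert.1 (hK a (Finset.mem_insert_self _ _) ρ hρ) with h | h
      · exact absurd hρ.dim_lt (by rw [h]; exact lt_irrefl _)
      · exact h
    have hbd : a.bd ⊆ ⋃ σ ∈ s, σ.carrier := by
      intro x hx
      obtain ⟨ρ, hρ, hxρ⟩ := exists_isFacet_of_mem_bd hx
      exact Set.mem_biUnion (hfac ρ hρ) hxρ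
    obtain ⟨g', hc', he', hQ'⟩ := hext a (Finset.mem_insert_self _ _) g (hgc.mono hbd)
      fun ρ hρ => hgQ ρ (hfac ρ hρ)
    have heq : Set.EqOn (a.carrier.piecewise g' g) g (⋃ σ ∈ s, σ.carrier) := by
      intro x hx
      by_cases hxa : x ∈ a.carrier
      · rw [Set.piecewise_eq_of_mem _ _ _ hxa]
        obtain ⟨σ, hσ, hxσ⟩ := Set.mem_iUnion₂.1 hx
        exact he' (mem_bd_of_mem_of_mem hxa hxσ (fun h => ha (h ▸ hσ)) (hmax σ hσ))
      · rw [Set.piecewise_eq_of_notMem _ _ _ hxa]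
    refine ⟨a.carrier.piecewise g' g, ?_, ?_⟩
    · rw [Finset.set_biUnion_insert]
      refine ContinuousOn.union_of_isClosed (hc'.congr (Set.piecewise_eqOn _ _ _))
        (hgc.congr heq) a.isClosed_carrier ?_
      exact s.finite_toSet.isClosed_biUnion fun σ _ => σ.isClosed_carrier
    · intro σ hσ
      rcases Finset.mem_insert.1 hσ with rfl | hσ
      · exact hcongr _ _ _ (Set.piecewise_eqOn _ _ _).symm hQ'
      · exact hcongr _ _ _ (heq.mono (Set.subset_biUnion_of_mem (u := fun σ => σ.carrier) hσ)).symm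
          (hgQ σ hσ)

end GridCell

/-- The unit cube in `ι → ℝ`. -/
def unitBox (ι : Type*) : Set (ι → ℝ) := {x | ∀ i, 0 ≤ x i ∧ x i ≤ 1}

/-- The boundary of the unit cube in `ι → ℝ`. -/
def unitBoxBd (ι : Type*) : Set (ι → ℝ) := {x | x ∈ unitBox ι ∧ ∃ i, x i = 0 ∨ x i = 1}

/-- Every map from the boundary of a cube of dimension less than `k` to `C` extends to the cube;
in other words `C` is `(k - 2)`-connected. -/
def ExtendsBelow {E : Type*} [TopologicalSpace E] (k : ℕ) (C : Set E) : Prop :=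
  ∀ (ι : Type) [Fintype ι], Fintype.card ι < k → ∀ g : (ι → ℝ) → E,
    ContinuousOn g (unitBoxBd ι) → Set.MapsTo g (unitBoxBd ι) C →
    ∃ g', ContinuousOn g' (unitBox ι) ∧ Set.MapsTo g' (unitBox ι) C ∧ Set.EqOn g' g (unitBoxBd ι)

theorem isClosed_unitBox (ι : Type*) : IsClosed (unitBox ι) := by
  have : unitBox ι = ⋂ i, {x : ι → ℝ | 0 ≤ x i ∧ x i ≤ 1} := by
    ext x; simp [unitBox]
  rw [this]
  exact isClosed_iInter fun i => (isClosed_le continuous_const (continuous_apply i)).inter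
    (isClosed_le (continuous_apply i) continuous_const)

theorem mem_unitBox_iff {ι : Type*} [Fintype ι] {x : ι → ℝ} :
    x ∈ unitBox ι ↔ ‖x - fun _ => (1 / 2 : ℝ)‖ ≤ 1 / 2 := by
  rw [pi_norm_le_iff_of_nonneg (by norm_num)]
  refine forall_congr' fun i => ?_
  rw [Pi.sub_apply, Real.norm_eq_abs, abs_le]
  constructor <;> rintro ⟨h1, h2⟩ <;> constructor <;> linarith

theorem mem_unitBoxBd_iff {ι : Type*} [Fintype ι] [Nonempty ι] {x : ι → ℝ} :
    x ∈ unitBoxBd ι ↔ ‖x - fun _ => (1 / 2 : ℝ)‖ = 1 / 2 := by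
  constructor
  · rintro ⟨hx, i, hi⟩
    refine le_antisymm (mem_unitBox_iff.1 hx) (le_trans ?_ (norm_le_pi_norm _ i))
    rw [Pi.sub_apply, Real.norm_eq_abs, le_abs]
    rcases hi with hi | hi <;> rw [hi] <;> norm_num
  · intro h
    have hx : x ∈ unitBox ι := mem_unitBox_iff.2 h.le
    refine ⟨hx, ?_⟩
    by_contra! hcon
    refine h.not_lt ((pi_norm_lt_iff (by norm_num)).2 fun i => ?_)
    have h1 := lt_of_le_of_ne (hx i).1 (Ne.symm (hcon i).1)
    have h2 := lt_of_le_of_ne (hx i).2 (hcon i).2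
    rw [Pi.sub_apply, Real.norm_eq_abs, abs_lt]
    constructor <;> linarith

/-- Extendability over the cube is invariant under homotopies on its boundary. -/
theorem exists_extension_of_homotopy {ι : Type*} [Fintype ι] {E : Type*} [TopologicalSpace E]
    {C : Set E} {g G : (ι → ℝ) → E} {H : ℝ × (ι → ℝ) → E}
    (hH : ContinuousOn H (Set.Icc 0 1 ×ˢ unitBoxBd ι))
    (hHC : Set.MapsTo H (Set.Icc 0 1 ×ˢ unitBoxBd ι) C)
    (hH0 : ∀ x ∈ unitBoxBd ι, H (0, x) = g x) (hH1 : ∀ x ∈ unitBoxBd ι, H (1, x) = G x)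
    (hG : ContinuousOn G (unitBox ι)) (hGC : Set.MapsTo G (unitBox ι) C) :
    ∃ g', ContinuousOn g' (unitBox ι) ∧ Set.MapsTo g' (unitBox ι) C ∧
      Set.EqOn g' g (unitBoxBd ι) := by
  rcases isEmpty_or_nonempty ι with hι | hι
  · exact ⟨G, hG, hGC, fun x hx => (IsEmpty.exists_iff.1 hx.2).elim⟩
  set c : ι → ℝ := fun _ => 1 / 2 with hc
  set u : (ι → ℝ) → ℝ := fun x => 2 * ‖x - c‖ with hu
  have huc : Continuous u := by fun_prop
  set P : (ι → ℝ) → ι → ℝ := fun x => c + (u x)⁻¹ • (x - c) with hP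
  set D : (ι → ℝ) → ι → ℝ := fun x => c + (2 : ℝ) • (x - c) with hD
  have hbox : ∀ x, x ∈ unitBox ι ↔ u x ≤ 1 := fun x => by
    rw [mem_unitBox_iff, hu]; constructor <;> intro h <;> simp only at * <;> linarith
  have hbd : ∀ x, x ∈ unitBoxBd ι ↔ u x = 1 := fun x => by
    rw [mem_unitBoxBd_iff, hu]; constructor <;> intro h <;> simp only at * <;> linarith
  have hPbd : ∀ x, 1 / 2 ≤ u x → P x ∈ unitBoxBd ι := fun x hx => by
    rw [hbd]
    have h0 : 0 < u x := by linarith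
    have : u (P x) = (u x)⁻¹ * u x := by
      simp only [hu, hP, add_sub_cancel_left, norm_smul, norm_inv, Real.norm_eq_abs]
      rw [abs_of_nonneg (by positivity)]; ring
    rw [this, inv_mul_cancel₀ h0.ne']
  have hDbox : ∀ x, u x ≤ 1 / 2 → D x ∈ unitBox ι := fun x hx => by
    rw [hbox]
    have : u (D x) = 2 * u x := by
      simp only [hu, hD, add_sub_cancel_left, norm_smul]
      norm_num
    linarith
  have hcover : unitBox ι =
      {x | x ∈ unitBox ι ∧ 1 / 2 ≤ u x} ∪ {x | x ∈ unitBox ι ∧ u x ≤ 1 / 2} := by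
    ext x
    change x ∈ unitBox ι ↔ _ ∨ _
    exact ⟨fun h => (le_total _ _).imp (⟨h, ·⟩) (⟨h, ·⟩), fun h => h.elim (·.1) (·.1)⟩
  have hmem : ∀ x ∈ {x | x ∈ unitBox ι ∧ 1 / 2 ≤ u x},
      (2 - 2 * u x, P x) ∈ Set.Icc (0 : ℝ) 1 ×ˢ unitBoxBd ι := by
    rintro x ⟨h1, h2⟩
    have := (hbox x).1 h1
    exact ⟨⟨by simp only; linarith, by simp only; linarith⟩, hPbd x h2⟩
  refine ⟨fun x => if 1 / 2 ≤ u x then H (2 - 2 * u x, P x) else G (D x), ?_, ?_, ?_⟩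
  · rw [hcover]
    refine ContinuousOn.union_of_isClosed ?_ ?_
      ((isClosed_unitBox ι).inter (isClosed_le continuous_const huc))
      ((isClosed_unitBox ι).inter (isClosed_le huc continuous_const))
    · have hcP : ContinuousOn (fun x => (2 - 2 * u x, P x)) {x | x ∈ unitBox ι ∧ 1 / 2 ≤ u x} := by
        refine ContinuousOn.prodMk (by fun_prop) (continuousOn_const.add
          (ContinuousOn.smul (huc.continuousOn.inv₀ ?_) (by fun_prop)))
        intro x hx
        have := hx.2
        positivity
      refine (hH.comp hcP hmem).congr fun x hx => ?_
      simp only [Function.comp]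
      rw [if_pos hx.2]
    · refine (hG.comp (f := D) (by fun_prop) fun x hx => hDbox x hx.2).congr fun x hx => ?_
      by_cases h : 1 / 2 ≤ u x
      · have he : u x = 1 / 2 := le_antisymm hx.2 h
        have hPD : P x = D x := by simp only [hP, hD, he]; norm_num
        simp only [Function.comp]
        rw [if_pos h, he, ← hPD, ← hH1 _ (hPbd x h)]
        norm_num
      · simp only [Function.comp]
        rw [if_neg h]
  · intro x hx
    by_cases h : 1 / 2 ≤ u x
    · simp only [if_pos h]
      exact hHC (hmem x ⟨hx, h⟩)
    · simp only [if_neg h]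
      exact hGC (hDbox x (not_le.1 h).le)
  · intro x hx
    have h1 := (hbd x).1 hx
    have hPx : P x = x := by simp [hP, h1]
    simp only [h1]
    rw [if_pos (by norm_num), hPx, ← hH0 x hx]
    norm_num

/-- The extension property for standard cubes gives the one for grid cells. -/
theorem ExtendsBelow.exists_extension_cell {κ : Type} [Fintype κ] {E : Type*} [TopologicalSpace E]
    {k : ℕ} {C : Set E} (hC : ExtendsBelow k C) (σ : GridCell κ) (hσ : σ.dim < k)
    {g : (κ → ℝ) → E} (hg : ContinuousOn g σ.bd) (hgC : Set.MapsTo g σ.bd C) :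
    ∃ g', ContinuousOn g' σ.carrier ∧ Set.EqOn g' g σ.bd ∧ Set.MapsTo g' σ.carrier C := by
  classical
  set φ : ({i // (σ i).2 = true} → ℝ) → κ → ℝ := fun u i =>
    if h : (σ i).2 = true then (σ i).1 + u ⟨i, h⟩ else (σ i).1 with hφ
  set ψ : (κ → ℝ) → {i // (σ i).2 = true} → ℝ := fun x i => x i - (σ i).1 with hψ
  have hφc : Continuous φ := by
    refine continuous_pi fun i => ?_
    by_cases h : (σ i).2 = true
    · simp only [hφ, h, dite_true]; fun_prop
    · simp only [hφ, dif_neg h]; fun_prop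
  have hφψ : ∀ x ∈ σ.carrier, φ (ψ x) = x := by
    intro x hx
    funext i
    by_cases h : (σ i).2 = true
    · simp [hφ, hψ, h]
    · have := hx i
      simp only [h] at this
      simp only [hφ, h]
      simp at this ⊢
      linarith
  have hφm : Set.MapsTo φ (unitBoxBd _) σ.bd := by
    rintro u ⟨hu, ⟨i, hi⟩, h⟩
    refine ⟨fun j => ?_, i, hi, ?_⟩
    · by_cases hj : (σ j).2 = true
      · have := hu ⟨j, hj⟩
        simp only [hφ, hj, dite_true, if_true]
        constructor <;> linarith
      · simp [hφ, hj]
    · simp only [hφ, hi, dite_true]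
      rcases h with h | h <;> simp [h]
  have hψm : Set.MapsTo ψ σ.carrier (unitBox _) := by
    intro x hx ⟨i, hi⟩
    have := hx i
    simp only [hi, if_true] at this
    simp only [hψ]
    constructor <;> linarith
  have hψb : Set.MapsTo ψ σ.bd (unitBoxBd _) := by
    rintro x ⟨hx, i, hi, h⟩
    refine ⟨hψm hx, ⟨i, hi⟩, ?_⟩
    rcases h with h | h <;> simp [hψ, h]
  obtain ⟨g', h1, h2, h3⟩ := hC {i // (σ i).2 = true} hσ (g ∘ φ) (hg.comp hφc.continuousOn hφm)
    (hgC.comp hφm)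
  refine ⟨g' ∘ ψ, h1.comp (by fun_prop) hψm, fun x hx => ?_, h2.comp hψm⟩
  simp only [Function.comp]
  rw [h3 (hψb hx), Function.comp, hφψ x hx.1]

namespace GridCell

theorem mem_carrier_option {ι : Type*} {σ : GridCell (Option ι)} {x : Option ι → ℝ} :
    x ∈ σ.carrier ↔
      (((σ none).1 : ℝ) ≤ x none ∧ x none ≤ (σ none).1 + if (σ none).2 then 1 else 0) ∧
      (fun i => x (some i)) ∈ carrier (fun i => σ (some i)) :=
  Option.forall

theorem IsFacet.option {ι : Type*} {ρ σ : GridCell (Option ι)} (h : IsFacet ρ σ) :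
    (ρ none = σ none ∧ IsFacet (fun i => ρ (some i)) fun i => σ (some i)) ∨
    ((σ none).2 = true ∧ (ρ none = ((σ none).1, false) ∨ ρ none = ((σ none).1 + 1, false)) ∧
      (fun i => ρ (some i)) = fun i => σ (some i)) := by
  obtain ⟨i, hi, hρ, hj⟩ := h
  cases i with
  | none => exact Or.inr ⟨hi, hρ, funext fun i => hj _ (by simp)⟩
  | some i => exact Or.inl ⟨hj _ (by simp), i, hi, hρ, fun j hji => hj _ (by simpa using hji)⟩

theorem dim_option {ι : Type*} [Fintype ι] {σ : GridCell (Option ι)} (h : (σ none).2 = false) :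
    σ.dim = dim fun i => σ (some i) := by
  refine (Fintype.card_congr ⟨fun j => ⟨some j.1, j.2⟩, ?_, ?_, ?_⟩).symm
  · rintro ⟨j | j, hj⟩
    · exact absurd hj (by simp [h])
    · exact ⟨j, hj⟩
  · intro j; rfl
  · rintro ⟨j | j, hj⟩
    · exact absurd hj (by simp [h])
    · rfl

/-- If a map sends every cell of a grid complex of dimension less than `k` to `A` or to `B`, with
`B` weakly contractible and `A ∩ B` sufficiently connected, then it can be deformed into `A`
relative to the cells which are already mapped to `A`. -/
theorem exists_homotopy {ι : Type} [Fintype ι] {E : Type*} [TopologicalSpace E] [Nonempty E]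
    {k : ℕ} {A B L : Set E} (hL : ExtendsBelow k L) (hB : ∀ m, ExtendsBelow m B) (hLA : L ⊆ A)
    (hLB : L ⊆ B) (hAB : A ∩ B ⊆ L) (s : Finset (GridCell ι))
    (hs : ∀ τ ∈ s, ∀ ρ, IsFacet ρ τ → ρ ∈ s) (hdim : ∀ τ ∈ s, τ.dim < k) {f : (ι → ℝ) → E}
    (hf : ContinuousOn f (⋃ τ ∈ s, τ.carrier))
    (hfs : ∀ τ ∈ s, Set.MapsTo f τ.carrier A ∨ Set.MapsTo f τ.carrier B) :
    ∃ h : ℝ × (ι → ℝ) → E, ContinuousOn h (Set.Icc 0 1 ×ˢ ⋃ τ ∈ s, τ.carrier) ∧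
      Set.MapsTo h (Set.Icc 0 1 ×ˢ ⋃ τ ∈ s, τ.carrier) (A ∪ B) ∧
      (∀ x ∈ ⋃ τ ∈ s, τ.carrier, h (0, x) = f x) ∧ (∀ x ∈ ⋃ τ ∈ s, τ.carrier, h (1, x) ∈ A) ∧
      ∀ τ ∈ s, Set.MapsTo f τ.carrier A → ∀ x ∈ τ.carrier, ∀ t ∈ Set.Icc (0 : ℝ) 1,
        h (t, x) = f x := by
  classical
  set T : Finset (ℤ × Bool) := {(0, false), (1, false), (0, true)} with hT
  set K : Finset (GridCell (Option ι)) :=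
    (T ×ˢ s).image fun q o => o.elim q.1 q.2 with hKdef
  have hmemK : ∀ σ : GridCell (Option ι), σ ∈ K ↔ σ none ∈ T ∧ (fun i => σ (some i)) ∈ s := by
    intro σ
    rw [hKdef, Finset.mem_image]
    constructor
    · rintro ⟨q, hq, rfl⟩
      exact Finset.mem_product.1 hq
    · intro h
      refine ⟨(σ none, fun i => σ (some i)), Finset.mem_product.2 h, ?_⟩
      funext o
      cases o <;> rfl
  set Q : GridCell (Option ι) → ((Option ι → ℝ) → E) → Prop := fun σ h =>
    (Set.MapsTo f (carrier fun i => σ (some i)) A → ∀ x ∈ σ.carrier, h x = f fun i => x (some i)) ∧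
    (¬ Set.MapsTo f (carrier fun i => σ (some i)) A → Set.MapsTo h σ.carrier B) ∧
    (¬ Set.MapsTo f (carrier fun i => σ (some i)) A → σ none = (1, false) →
      Set.MapsTo h σ.carrier L) ∧
    (σ none = (0, false) → ∀ x ∈ σ.carrier, h x = f fun i => x (some i)) with hQ
  have hcongr : ∀ σ g g', Set.EqOn g g' σ.carrier → Q σ g → Q σ g' := by
    rintro σ g g' he ⟨h1, h2, h3, h4⟩
    exact ⟨fun h x hx => (he hx).symm.trans (h1 h x hx), fun h => (h2 h).congr he,
      fun h h' => (h3 h h').congr he, fun h x hx => (he hx).symm.trans (h4 h x hx)⟩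
  have hK : ∀ σ ∈ K, ∀ ρ, IsFacet ρ σ → ρ ∈ K := by
    intro σ hσ ρ hρ
    rw [hmemK] at hσ ⊢
    rcases hρ.option with ⟨h1, h2⟩ | ⟨h1, h2, h3⟩
    · exact ⟨h1 ▸ hσ.1, hs _ hσ.2 _ h2⟩
    · rw [h3]
      refine ⟨?_, hσ.2⟩
      have := hσ.1
      simp only [hT, Finset.mem_insert, Finset.mem_singleton] at this ⊢
      rcases this with h | h | h <;> simp [h] at h1 h2 ⊢
      tauto
  have hface : ∀ {σ ρ : GridCell (Option ι)}, IsFacet ρ σ →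
      carrier (fun i => ρ (some i)) ⊆ carrier fun i => σ (some i) := by
    intro σ ρ hρ
    rcases hρ.option with ⟨-, h2⟩ | ⟨-, -, h3⟩
    · exact h2.carrier_subset
    · rw [h3]
  obtain ⟨h, hc, hQh⟩ := exists_cellwise_extension K Q hcongr hK (by
    intro σ hσ g hg hQρ
    have hσ' := (hmemK σ).1 hσ
    have hsub : carrier (fun i => σ (some i)) ⊆ ⋃ τ ∈ s, τ.carrier :=
      Set.subset_biUnion_of_mem (u := fun τ : GridCell ι => τ.carrier) hσ'.2
    have hmaps : Set.MapsTo (fun (x : Option ι → ℝ) i => x (some i)) σ.carrier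
        (carrier fun i => σ (some i)) := fun x hx => (mem_carrier_option.1 hx).2
    by_cases hA : Set.MapsTo f (carrier fun i => σ (some i)) A
    · refine ⟨fun x => f fun i => x (some i), (hf.mono hsub).comp (by fun_prop) hmaps, ?_, ?_⟩
      · intro x hx
        obtain ⟨ρ, hρ, hxρ⟩ := exists_isFacet_of_mem_bd hx
        exact ((hQρ ρ hρ).1 (hA.mono_left (hface hρ)) x hxρ).symm
      · exact ⟨fun _ _ _ => rfl, fun h => absurd hA h, fun h => absurd hA h, fun _ _ _ => rfl⟩
    have hB' : Set.MapsTo f (carrier fun i => σ (some i)) B := (hfs _ hσ'.2).resolve_left hA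
    have hgB : Set.MapsTo g σ.bd B := by
      intro x hx
      obtain ⟨ρ, hρ, hxρ⟩ := exists_isFacet_of_mem_bd hx
      by_cases hAρ : Set.MapsTo f (carrier fun i => ρ (some i)) A
      · rw [(hQρ ρ hρ).1 hAρ x hxρ]
        exact hB' (hmaps hx.1)
      · exact (hQρ ρ hρ).2.1 hAρ hxρ
    have hside : (σ none).2 = false → ∀ ρ, IsFacet ρ σ → ρ none = σ none := by
      intro h0 ρ hρ
      rcases hρ.option with ⟨h1, -⟩ | ⟨h1, -, -⟩
      · exact h1
      · rw [h0] at h1; simp at h1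
    have hcases := hσ'.1
    simp only [hT, Finset.mem_insert, Finset.mem_singleton] at hcases
    rcases hcases with h0 | h0 | h0
    · refine ⟨fun x => f fun i => x (some i), (hf.mono hsub).comp (by fun_prop) hmaps, ?_, ?_⟩
      · intro x hx
        obtain ⟨ρ, hρ, hxρ⟩ := exists_isFacet_of_mem_bd hx
        exact ((hQρ ρ hρ).2.2.2 ((hside (by simp [h0]) ρ hρ).trans h0) x hxρ).symm
      · exact ⟨fun _ _ _ => rfl, fun _ x hx => hB' (hmaps hx),
          fun _ h => absurd (h0.symm.trans h) (by simp), fun _ _ _ => rfl⟩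
    · have hgL : Set.MapsTo g σ.bd L := by
        intro x hx
        obtain ⟨ρ, hρ, hxρ⟩ := exists_isFacet_of_mem_bd hx
        by_cases hAρ : Set.MapsTo f (carrier fun i => ρ (some i)) A
        · rw [(hQρ ρ hρ).1 hAρ x hxρ]
          exact hAB ⟨hAρ (mem_carrier_option.1 hxρ).2, hB' (hmaps hx.1)⟩
        · exact (hQρ ρ hρ).2.2.1 hAρ ((hside (by simp [h0]) ρ hρ).trans h0) hxρ
      obtain ⟨g', h1, h2, h3⟩ := hL.exists_extension_cell σ
        (by rw [dim_option (by simp [h0])]; exact hdim _ hσ'.2) hg hgL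
      exact ⟨g', h1, h2, fun h => absurd h hA, fun _ => h3.mono_right hLB, fun _ _ => h3,
        fun h => absurd (h0.symm.trans h) (by simp)⟩
    · obtain ⟨g', h1, h2, h3⟩ :=
        (hB (σ.dim + 1)).exists_extension_cell σ (Nat.lt_succ_self _) hg hgB
      exact ⟨g', h1, h2, fun h => absurd h hA, fun _ => h3,
        fun _ h => absurd (h0.symm.trans h) (by simp),
        fun h => absurd (h0.symm.trans h) (by simp)⟩)
  have hin : ∀ (c : ℤ × Bool), c ∈ T → ∀ τ ∈ s, (fun o : Option ι => o.elim c τ) ∈ K :=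
    fun c hc τ hτ => (hmemK _).2 ⟨hc, hτ⟩
  have hpt : ∀ (c : ℤ × Bool) (τ : GridCell ι) (t : ℝ) (x : ι → ℝ),
      (c.1 : ℝ) ≤ t ∧ t ≤ c.1 + (if c.2 then 1 else 0) → x ∈ τ.carrier →
      (fun o : Option ι => o.elim t x) ∈ carrier (fun o : Option ι => o.elim c τ) :=
    fun c τ t x ht hx => mem_carrier_option.2 ⟨ht, hx⟩
  have hprism : ∀ τ ∈ s, ∀ x ∈ τ.carrier, ∀ t ∈ Set.Icc (0 : ℝ) 1,
      (fun o : Option ι => o.elim t x) ∈ carrier (fun o : Option ι => o.elim (0, true) τ) :=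
    fun τ hτ x hx t ht => hpt _ _ _ _ (by simpa using ht) hx
  refine ⟨fun q => h fun o => o.elim q.1 q.2, ?_, ?_, ?_, ?_, ?_⟩
  · refine hc.comp (Continuous.continuousOn ?_) ?_
    · refine continuous_pi fun o => ?_
      cases o with
      | none => exact continuous_fst
      | some i => exact (continuous_apply i).comp continuous_snd
    · rintro ⟨t, x⟩ ⟨ht, hx⟩
      obtain ⟨τ, hτ, hx⟩ := Set.mem_iUnion₂.1 hx
      exact Set.mem_biUnion (hin (0, true) (by simp [hT]) τ hτ) (hprism τ hτ x hx t ht)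
  · rintro ⟨t, x⟩ ⟨ht, hx⟩
    obtain ⟨τ, hτ, hx⟩ := Set.mem_iUnion₂.1 hx
    have hq := hQh _ (hin (0, true) (by simp [hT]) τ hτ)
    have hm := hprism τ hτ x hx t ht
    by_cases hA : Set.MapsTo f τ.carrier A
    · left
      have := hq.1 hA _ hm
      simp only at this ⊢
      rw [this]
      exact hA hx
    · exact Or.inr (hq.2.1 hA hm)
  · intro x hx
    obtain ⟨τ, hτ, hx⟩ := Set.mem_iUnion₂.1 hx
    exact (hQh _ (hin (0, false) (by simp [hT]) τ hτ)).2.2.2 rfl _ (hpt _ _ _ _ (by simp) hx)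
  · intro x hx
    obtain ⟨τ, hτ, hx⟩ := Set.mem_iUnion₂.1 hx
    have hq := hQh _ (hin (1, false) (by simp [hT]) τ hτ)
    have hm := hpt (1, false) τ 1 x (by simp) hx
    by_cases hA : Set.MapsTo f τ.carrier A
    · have := hq.1 hA _ hm
      simp only at this ⊢
      rw [this]
      exact hA hx
    · exact hLA (hq.2.2.1 hA rfl hm)
  · intro τ hτ hA x hx t ht
    exact (hQh _ (hin (0, true) (by simp [hT]) τ hτ)).1 hA _ (hprism τ hτ x hx t ht)

end GridCell

theorem isCompact_unitBox (ι : Type*) : IsCompact (unitBox ι) := by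
  have : unitBox ι = Set.Icc 0 1 := by
    ext x
    exact forall_and
  rw [this]
  exact isCompact_Icc

theorem unitBoxBd_subset (ι : Type*) : unitBoxBd ι ⊆ unitBox ι := fun _ h => h.1

theorem isCompact_unitBoxBd (ι : Type*) [Finite ι] : IsCompact (unitBoxBd ι) := by
  refine (isCompact_unitBox ι).of_isClosed_subset ?_ (unitBoxBd_subset ι)
  have : unitBoxBd ι = unitBox ι ∩ ⋃ i, {x : ι → ℝ | x i = 0 ∨ x i = 1} := by
    ext x; simp [unitBoxBd]
  rw [this]
  exact (isClosed_unitBox ι).inter (isClosed_iUnion_of_finite fun i =>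
    (isClosed_eq (continuous_apply i) continuous_const).union
      (isClosed_eq (continuous_apply i) continuous_const))

/-- `D` is a union of cells of dimension less than `k` in arbitrarily fine grids, and `D'` is a
union of cells of these. -/
def IsGridded {ι : Type*} [Fintype ι] (k : ℕ) (D D' : Set (ι → ℝ)) : Prop :=
  ∀ N : ℕ, 0 < N → ∃ s : Finset (GridCell ι), (∀ τ ∈ s, ∀ ρ, GridCell.IsFacet ρ τ → ρ ∈ s) ∧
    (∀ τ ∈ s, τ.dim < k) ∧ (⋃ τ ∈ s, τ.carrier) = {y | (N : ℝ)⁻¹ • y ∈ D} ∧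
    ∀ x, (N : ℝ)⁻¹ • x ∈ D' → ∃ τ ∈ s, x ∈ τ.carrier ∧ ∀ y ∈ τ.carrier, (N : ℝ)⁻¹ • y ∈ D'

namespace GridCell

/-- The cells of the cube `[0, N]^ι`. -/
noncomputable def boxCells (ι : Type*) [Fintype ι] (N : ℕ) : Finset (GridCell ι) := by
  classical
  exact Fintype.piFinset fun _ => (Finset.Icc (0 : ℤ) N ×ˢ Finset.univ).filter
    fun c => c.1 + (if c.2 then 1 else 0) ≤ N

theorem mem_boxCells {ι : Type*} [Fintype ι] {N : ℕ} {σ : GridCell ι} :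
    σ ∈ boxCells ι N ↔ ∀ i, 0 ≤ (σ i).1 ∧ (σ i).1 + (if (σ i).2 then 1 else 0) ≤ N := by
  simp only [boxCells, Fintype.mem_piFinset, Finset.mem_filter, Finset.mem_product, Finset.mem_Icc,
    Finset.mem_univ, and_true]
  refine forall_congr' fun i => ⟨fun h => ⟨h.1.1, h.2⟩, fun h => ⟨⟨h.1, ?_⟩, h.2⟩⟩
  have := h.2
  split_ifs at this <;> omega

theorem IsFacet.mem_boxCells {ι : Type*} [Fintype ι] {N : ℕ} {ρ σ : GridCell ι}
    (h : IsFacet ρ σ) (hσ : σ ∈ boxCells ι N) : ρ ∈ boxCells ι N := by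
  rw [GridCell.mem_boxCells] at hσ ⊢
  obtain ⟨i, hi, hρ, hj⟩ := h
  intro j
  have := hσ j
  by_cases hji : j = i
  · subst hji
    simp only [hi, if_true] at this
    rcases hρ with hρ | hρ <;> simp [hρ] <;> omega
  · rwa [hj j hji]

/-- The minimal grid cell containing a point. -/
noncomputable def ofPoint {ι : Type*} (x : ι → ℝ) : GridCell ι := by
  classical
  exact fun i => (⌊x i⌋, decide (x i ≠ ⌊x i⌋))

theorem mem_carrier_ofPoint {ι : Type*} (x : ι → ℝ) : x ∈ (ofPoint x).carrier := by
  intro i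
  refine ⟨Int.floor_le _, ?_⟩
  by_cases h : x i = ⌊x i⌋
  · simp only [ofPoint, ← h]; simp
  · simp [ofPoint, h, (Int.lt_floor_add_one (x i)).le]

theorem ofPoint_mem_boxCells {ι : Type*} [Fintype ι] {N : ℕ} {x : ι → ℝ}
    (hx : ∀ i, 0 ≤ x i ∧ x i ≤ N) : ofPoint x ∈ boxCells ι N := by
  rw [mem_boxCells]
  intro i
  obtain ⟨h0, h1⟩ := hx i
  refine ⟨Int.floor_nonneg.2 h0, ?_⟩
  have hle : ⌊x i⌋ ≤ N := by
    have := (Int.floor_le (x i)).trans h1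
    exact_mod_cast this
  by_cases h : x i = ⌊x i⌋
  · simpa [ofPoint, ← h] using hle
  · simp only [ofPoint]
    have : ⌊x i⌋ ≠ N := by
      intro he
      apply h
      have h2 := Int.floor_le (x i)
      rw [he] at h2 ⊢
      push_cast at h2 ⊢
      linarith
    simp
    omega

theorem ofPoint_of_eq_int {ι : Type*} {x : ι → ℝ} {i : ι} {n : ℤ} (h : x i = n) :
    ofPoint x i = (n, false) := by
  simp [ofPoint, h]

theorem mem_box_of_mem_carrier {ι : Type*} [Fintype ι] {N : ℕ} {σ : GridCell ι}
    (hσ : σ ∈ boxCells ι N) {x : ι → ℝ} (hx : x ∈ σ.carrier) (i : ι) : 0 ≤ x i ∧ x i ≤ N := by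
  have h1 := mem_boxCells.1 hσ i
  have h2 := hx i
  have h3 : (0 : ℝ) ≤ (σ i).1 := by exact_mod_cast h1.1
  have h4 : ((σ i).1 : ℝ) + (if (σ i).2 then 1 else 0) ≤ N := by exact_mod_cast h1.2
  exact ⟨by linarith, by linarith⟩

end GridCell

theorem inv_smul_mem_unitBox {ι : Type*} {N : ℕ} (hN : 0 < N) {x : ι → ℝ} :
    (N : ℝ)⁻¹ • x ∈ unitBox ι ↔ ∀ i, 0 ≤ x i ∧ x i ≤ N := by
  have hN' : (0 : ℝ) < N := by exact_mod_cast hN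
  refine forall_congr' fun i => and_congr ?_ ?_
  · rw [Pi.smul_apply, smul_eq_mul]
    exact mul_nonneg_iff_of_pos_left (by positivity)
  · rw [Pi.smul_apply, smul_eq_mul, inv_mul_le_iff₀ hN', mul_one]

theorem inv_smul_mem_unitBoxBd {ι : Type*} {N : ℕ} (hN : 0 < N) {x : ι → ℝ} :
    (N : ℝ)⁻¹ • x ∈ unitBoxBd ι ↔ (∀ i, 0 ≤ x i ∧ x i ≤ N) ∧ ∃ i, x i = 0 ∨ x i = N := by
  have hN' : (N : ℝ) ≠ 0 := by positivity
  refine and_congr (inv_smul_mem_unitBox hN) (exists_congr fun i => or_congr ?_ ?_)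
  · simp [hN']
  · rw [Pi.smul_apply, smul_eq_mul, inv_mul_eq_iff_eq_mul₀ hN', mul_one]

open GridCell in
theorem exists_boundary_cell {ι : Type*} [Fintype ι] {N : ℕ} (hN : 0 < N) {x : ι → ℝ}
    (hx : (N : ℝ)⁻¹ • x ∈ unitBoxBd ι) :
    ofPoint x ∈ boxCells ι N ∧ ∃ i, ofPoint x i = (0, false) ∨ ofPoint x i = ((N : ℤ), false) := by
  obtain ⟨h, i, hi⟩ := (inv_smul_mem_unitBoxBd hN).1 hx
  exact ⟨ofPoint_mem_boxCells h, i, hi.imp (fun h => ofPoint_of_eq_int (by simp [h]))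
    (fun h => ofPoint_of_eq_int (by simp [h]))⟩

open GridCell in
theorem mem_unitBoxBd_of_mem_cell {ι : Type*} [Fintype ι] {N : ℕ} (hN : 0 < N) {σ : GridCell ι}
    (hσ : σ ∈ boxCells ι N) (hi : ∃ i, σ i = (0, false) ∨ σ i = ((N : ℤ), false)) {x : ι → ℝ}
    (hx : x ∈ σ.carrier) : (N : ℝ)⁻¹ • x ∈ unitBoxBd ι := by
  refine (inv_smul_mem_unitBoxBd hN).2 ⟨mem_box_of_mem_carrier hσ hx, ?_⟩
  obtain ⟨i, hi⟩ := hi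
  have := hx i
  refine ⟨i, hi.imp (fun h => ?_) (fun h => ?_)⟩ <;> rw [h] at this <;> simp at this <;> linarith

open GridCell in
theorem isGridded_unitBox (ι : Type*) [Fintype ι] :
    IsGridded (Fintype.card ι + 1) (unitBox ι) (unitBoxBd ι) := by
  intro N hN
  refine ⟨boxCells ι N, fun τ hτ ρ hρ => hρ.mem_boxCells hτ,
    fun τ _ => Nat.lt_succ_of_le (Fintype.card_subtype_le _), ?_, fun x hx => ?_⟩
  · ext x
    simp only [Set.mem_iUnion₂, exists_prop]
    refine Iff.trans ⟨?_, fun h => ?_⟩ (inv_smul_mem_unitBox hN).symm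
    · rintro ⟨τ, hτ, hx⟩
      exact mem_box_of_mem_carrier hτ hx
    · exact ⟨ofPoint x, ofPoint_mem_boxCells h, mem_carrier_ofPoint x⟩
  · obtain ⟨h1, h2⟩ := exists_boundary_cell hN hx
    exact ⟨ofPoint x, h1, mem_carrier_ofPoint x, fun y hy => mem_unitBoxBd_of_mem_cell hN h1 h2 hy⟩

open GridCell in
theorem isGridded_unitBoxBd (ι : Type*) [Fintype ι] :
    IsGridded (Fintype.card ι) (unitBoxBd ι) ∅ := by
  classical
  intro N hN
  refine ⟨(boxCells ι N).filter fun σ => ∃ i, σ i = (0, false) ∨ σ i = ((N : ℤ), false),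
    fun τ hτ ρ hρ => ?_, fun τ hτ => ?_, ?_, fun x hx => hx.elim⟩
  · rw [Finset.mem_filter] at hτ ⊢
    refine ⟨hρ.mem_boxCells hτ.1, ?_⟩
    obtain ⟨i, hi⟩ := hτ.2
    obtain ⟨j, hj, -, h⟩ := hρ
    refine ⟨i, ?_⟩
    rwa [h i]
    rintro rfl
    rcases hi with hi | hi <;> simp [hi] at hj
  · obtain ⟨i, hi⟩ := (Finset.mem_filter.1 hτ).2
    refine Fintype.card_subtype_lt (x := i) ?_
    rcases hi with hi | hi <;> simp [hi]
  · ext x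
    simp only [Set.mem_iUnion₂, exists_prop]
    constructor
    · rintro ⟨τ, hτ, hx⟩
      rw [Finset.mem_filter] at hτ
      exact mem_unitBoxBd_of_mem_cell hN hτ.1 hτ.2 hx
    · intro hx
      exact ⟨ofPoint x, Finset.mem_filter.2 (exists_boundary_cell hN hx), mem_carrier_ofPoint x⟩

/-- Deforming a map on a gridded set into `A`, when the target is covered by `A` and a weakly
contractible `B` with overlap detected by a function `r`. -/
theorem IsGridded.exists_homotopy {ι : Type} [Fintype ι] {k : ℕ} {D D' : Set (ι → ℝ)}
    (hD : IsGridded k D D') (hDc : IsCompact D) {E : Type*} [TopologicalSpace E] [Nonempty E]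
    {A B L : Set E} (hL : ExtendsBelow k L) (hB : ∀ m, ExtendsBelow m B) (hLA : L ⊆ A)
    (hLB : L ⊆ B) (hAB : A ∩ B ⊆ L) {f : (ι → ℝ) → E} (hf : ContinuousOn f D)
    {r : (ι → ℝ) → ℝ} (hr : ContinuousOn r D) (hrA : ∀ x ∈ D, r x ≤ 1 / 2 → f x ∈ A)
    (hrB : ∀ x ∈ D, 0 < r x → f x ∈ B) (hD' : Set.MapsTo f D' A) :
    ∃ h : ℝ × (ι → ℝ) → E, ContinuousOn h (Set.Icc 0 1 ×ˢ D) ∧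
      Set.MapsTo h (Set.Icc 0 1 ×ˢ D) (A ∪ B) ∧ (∀ x ∈ D, h (0, x) = f x) ∧
      (∀ x ∈ D, h (1, x) ∈ A) ∧ ∀ x ∈ D', ∀ t ∈ Set.Icc (0 : ℝ) 1, h (t, x) = f x := by
  obtain ⟨δ, hδ, hu⟩ := Metric.uniformContinuousOn_iff.1
    (hDc.uniformContinuousOn_of_continuous hr) (1 / 2) (by norm_num)
  obtain ⟨n, hn⟩ := exists_nat_one_div_lt hδ
  obtain ⟨s, hs, hdim, hU, hrel⟩ := hD (n + 1) n.succ_pos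
  set N : ℕ := n + 1 with hN
  have hN0 : (0 : ℝ) < N := by positivity
  have hsub : ∀ τ ∈ s, ∀ x ∈ τ.carrier, (N : ℝ)⁻¹ • x ∈ D := fun τ hτ x hx => by
    have : x ∈ ⋃ τ ∈ s, τ.carrier := Set.mem_biUnion hτ hx
    rwa [hU] at this
  have hback : ∀ x : ι → ℝ, (N : ℝ)⁻¹ • ((N : ℝ) • x) = x := fun x => by
    rw [smul_smul, inv_mul_cancel₀ hN0.ne', one_smul]
  have hdist : ∀ τ ∈ s, ∀ x ∈ τ.carrier, ∀ y ∈ τ.carrier,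
      dist ((N : ℝ)⁻¹ • x) ((N : ℝ)⁻¹ • y) < δ := by
    intro τ _ x hx y hy
    have h1 : dist x y ≤ 1 := by
      refine (dist_pi_le_iff zero_le_one).2 fun i => ?_
      have h1 := hx i
      have h2 := hy i
      rw [Real.dist_eq, abs_le]
      split_ifs at h1 h2 <;> constructor <;> linarith
    rw [dist_smul₀, norm_inv, Real.norm_natCast]
    calc (N : ℝ)⁻¹ * dist x y ≤ (N : ℝ)⁻¹ * 1 := by gcongr
      _ < δ := by rw [hN]; push_cast; simpa using hn
  have hmN : Set.MapsTo (fun x : ι → ℝ => (N : ℝ)⁻¹ • x) (⋃ τ ∈ s, τ.carrier) D := by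
    rw [hU]; exact fun x hx => hx
  obtain ⟨h, h1, h2, h3, h4, h5⟩ := GridCell.exists_homotopy hL hB hLA hLB hAB s hs hdim
    (f := fun x => f ((N : ℝ)⁻¹ • x)) (hf.comp (by fun_prop) hmN) (by
      intro τ hτ
      by_cases hle : ∀ x ∈ τ.carrier, r ((N : ℝ)⁻¹ • x) ≤ 1 / 2
      · exact Or.inl fun x hx => hrA _ (hsub τ hτ x hx) (hle x hx)
      · push Not at hle
        obtain ⟨y, hy, hy'⟩ := hle
        refine Or.inr fun x hx => hrB _ (hsub τ hτ x hx) ?_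
        have := hu _ (hsub τ hτ x hx) _ (hsub τ hτ y hy) (hdist τ hτ x hx y hy)
        rw [Real.dist_eq, abs_lt] at this
        linarith [this.1])
  have hmem : ∀ x ∈ D, (N : ℝ) • x ∈ ⋃ τ ∈ s, τ.carrier := fun x hx => by
    rw [hU]
    change (N : ℝ)⁻¹ • ((N : ℝ) • x) ∈ D
    rwa [hback]
  have hmap : Set.MapsTo (fun q : ℝ × (ι → ℝ) => (q.1, (N : ℝ) • q.2)) (Set.Icc 0 1 ×ˢ D)
      (Set.Icc 0 1 ×ˢ ⋃ τ ∈ s, τ.carrier) := fun q hq => ⟨hq.1, hmem _ hq.2⟩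
  refine ⟨fun q => h (q.1, (N : ℝ) • q.2), h1.comp (by fun_prop) hmap, h2.comp hmap,
    fun x hx => ?_, fun x hx => h4 _ (hmem x hx), fun x hx t ht => ?_⟩
  · simp only [h3 _ (hmem x hx), hback]
  · obtain ⟨τ, hτ, hxτ, hy⟩ := hrel ((N : ℝ) • x) (by rwa [hback])
    have := h5 τ hτ (fun y hyτ => hD' (hy y hyτ)) _ hxτ t ht
    simpa only [hback] using this

section OrderComplex

open Classical in
/-- Radial push away from the vertex `v`, mapping points whose coordinate at `v` is at most `1 / 2`
to the link of `v`. -/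
noncomputable def vertexPush {X : Type*} (v : X) (y : X → ℝ) : X → ℝ := fun x =>
  if x = v then max 0 (2 * y v - 1) else y x / max (1 - y v) (1 / 2)

theorem continuous_vertexPush {X : Type*} (v : X) : Continuous (vertexPush v) := by
  refine continuous_pi fun x => ?_
  by_cases h : x = v
  · simp only [vertexPush, h, if_true]; fun_prop
  · simp only [vertexPush, h, if_false]
    refine Continuous.div (by fun_prop) (by fun_prop) fun y => ?_
    have := le_max_right (1 - y v) (1 / 2)
    positivity

theorem support_vertexPush_subset {X : Type*} {v : X} {y : X → ℝ} :
    Function.support (vertexPush v y) ⊆ Function.support y := by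
  intro x hx h0
  apply hx
  by_cases h : x = v
  · subst h; simp [vertexPush, h0]
  · simp [vertexPush, h, h0]

theorem vertexPush_eq_self {X : Type*} {v : X} {y : X → ℝ} (hy : y v = 0) : vertexPush v y = y := by
  funext x
  by_cases h : x = v
  · subst h; simp [vertexPush, hy]
  · simp only [vertexPush, h, if_false, hy]
    norm_num

theorem vertexPush_nonneg {X : Type*} {v : X} {y : X → ℝ} (hy : ∀ x, 0 ≤ y x) (x : X) :
    0 ≤ vertexPush v y x := by
  by_cases h : x = v
  · simp [vertexPush, h]
  · simp only [vertexPush, h, if_false]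
    exact div_nonneg (hy x) ((by norm_num : (0 : ℝ) ≤ 1 / 2).trans (le_max_right _ _))

theorem sum_vertexPush {X : Type*} [Fintype X] {v : X} {y : X → ℝ} (hy : ∑ x, y x = 1) :
    ∑ x, vertexPush v y x = 1 := by
  classical
  have h1 : ∑ x ∈ Finset.univ.erase v, y x = 1 - y v := by
    rw [← hy, ← Finset.add_sum_erase _ _ (Finset.mem_univ v)]; ring
  have h2 : ∑ x ∈ Finset.univ.erase v, vertexPush v y x = (1 - y v) / max (1 - y v) (1 / 2) := by
    rw [← h1, Finset.sum_div, h1]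
    refine Finset.sum_congr rfl fun x hx => ?_
    simp [vertexPush, Finset.ne_of_mem_erase hx]
  rw [← Finset.add_sum_erase _ _ (Finset.mem_univ v), h2]
  simp only [vertexPush, if_true]
  rcases le_total (y v) (1 / 2) with h | h
  · rw [max_eq_left (by linarith : 2 * y v - 1 ≤ 0), max_eq_left (by linarith), zero_add,
      div_self (by linarith)]
  · rw [max_eq_right (by linarith : 0 ≤ 2 * y v - 1), max_eq_right (by linarith)]
    ring

theorem apply_eq_zero_of_mem_geomRealOn {X : Type*} [Preorder X] {S : Set X} {v : X}
    (hv : v ∉ S) {y : X → ℝ} (hy : y ∈ geomRealOn S) : y v = 0 := by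
  by_contra h
  exact hv (hy.2.1 h)

variable {X : Type*} [PartialOrder X]

theorem mem_geomRealOn_iff [Fintype X] {S : Set X} {y : X → ℝ} :
    y ∈ geomRealOn S ↔ (∀ x, 0 ≤ y x) ∧ Function.support y ⊆ S ∧
      IsChain (· ≤ ·) (Function.support y) ∧ ∑ x, y x = 1 := by
  refine and_congr_right fun _ => and_congr_right fun _ => and_congr_right fun _ => ?_
  constructor
  · rintro ⟨s, hs, h⟩
    rw [← h]
    refine (Finset.sum_subset (Finset.subset_univ s) fun x _ hx => ?_).symm
    by_contra hne
    exact hx (hs hne)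
  · exact fun h => ⟨Finset.univ, by simp, h⟩

theorem segment_mem_geomRealOn [Fintype X] {S C : Set X} (hC : IsChain (· ≤ ·) C) (hCS : C ⊆ S)
    {y z : X → ℝ} (hy : ∀ x, 0 ≤ y x) (hz : ∀ x, 0 ≤ z x) (hy1 : ∑ x, y x = 1)
    (hz1 : ∑ x, z x = 1) (hyC : Function.support y ⊆ C) (hzC : Function.support z ⊆ C) {t : ℝ}
    (ht : t ∈ Set.Icc (0 : ℝ) 1) : (1 - t) • y + t • z ∈ geomRealOn S := by
  have hsupp : Function.support ((1 - t) • y + t • z) ⊆ C := by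
    intro x hx
    by_contra hxC
    have h1 : y x = 0 := by by_contra h; exact hxC (hyC h)
    have h2 : z x = 0 := by by_contra h; exact hxC (hzC h)
    exact hx (by simp [h1, h2])
  refine mem_geomRealOn_iff.2 ⟨fun x => ?_, hsupp.trans hCS, hC.mono hsupp, ?_⟩
  · have := mul_nonneg (sub_nonneg.2 ht.2) (hy x)
    have := mul_nonneg ht.1 (hz x)
    simp only [Pi.add_apply, Pi.smul_apply, smul_eq_mul]
    linarith
  · simp only [Pi.add_apply, Pi.smul_apply, smul_eq_mul, Finset.sum_add_distrib, ← Finset.mul_sum,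
      hy1, hz1]
    ring

theorem ExtendsBelow.mono {E : Type*} [TopologicalSpace E] {k l : ℕ} {C : Set E}
    (h : ExtendsBelow k C) (hl : l ≤ k) : ExtendsBelow l C :=
  fun ι _ hι => h ι (hι.trans_le hl)

/-- Order complexes of posets with an element comparable to all others are contractible. -/
theorem extendsBelow_geomRealOn_of_comparable [Finite X] {C : Set X} {v : X} (hv : v ∈ C)
    (hC : ∀ x ∈ C, x ≤ v ∨ v ≤ x) (m : ℕ) : ExtendsBelow m (geomRealOn C) := by
  classical
  have := Fintype.ofFinite X
  intro ι _ _ g hg hgC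
  have hsegm : ∀ y ∈ geomRealOn C, ∀ t ∈ Set.Icc (0 : ℝ) 1,
      (1 - t) • y + t • (Pi.single v 1 : X → ℝ) ∈ geomRealOn C := by
    intro y hy t ht
    obtain ⟨h1, h2, h3, h4⟩ := mem_geomRealOn_iff.1 hy
    refine segment_mem_geomRealOn (C := insert v (Function.support y)) (h3.insert fun x hx _ => ?_)
      (Set.insert_subset hv h2) h1 (fun x => ?_) h4 (by simp) (Set.subset_insert _ _) ?_ ht
    · exact (hC x (h2 hx)).symm
    · by_cases h : x = v
      · subst h; simp
      · simp [h]
    · intro x hx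
      by_cases h : x = v
      · exact Or.inl h
      · exact absurd hx (by simp [h])
  have hcone : (Pi.single v 1 : X → ℝ) ∈ geomRealOn C := by
    refine mem_geomRealOn_iff.2 ⟨fun x => ?_, ?_, ?_, by simp⟩
    · by_cases h : x = v
      · subst h; simp
      · simp [h]
    · rw [Pi.support_single_of_ne one_ne_zero]
      simpa using hv
    · rw [Pi.support_single_of_ne one_ne_zero]
      exact IsChain.singleton
  refine exists_extension_of_homotopy (G := fun _ => (Pi.single v 1 : X → ℝ))
    (H := fun q => (1 - q.1) • g q.2 + q.1 • (Pi.single v 1 : X → ℝ)) ?_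
    (fun q hq => hsegm _ (hgC hq.2) _ hq.1) (by simp) (by simp) continuousOn_const
    (fun _ _ => hcone)
  have : ContinuousOn (fun q : ℝ × (ι → ℝ) => g q.2) (Set.Icc 0 1 ×ˢ unitBoxBd ι) :=
    hg.comp continuous_snd.continuousOn fun q hq => hq.2
  exact ((by fun_prop : ContinuousOn (fun q : ℝ × (ι → ℝ) => 1 - q.1) _).smul this).add
    (continuousOn_fst.smul continuousOn_const)

/-- The link of `v` in the order complex of `S`. -/
def posetLink (v : X) (S : Set X) : Set X := {x | x ∈ S ∧ (x < v ∨ v < x)}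

theorem vertexPush_mem [Finite X] {S T : Set X} {v : X} {y : X → ℝ} (hy : y ∈ geomRealOn S)
    (hT : Function.support (vertexPush v y) ⊆ T) : vertexPush v y ∈ geomRealOn T := by
  have := Fintype.ofFinite X
  obtain ⟨h1, -, h3, h4⟩ := mem_geomRealOn_iff.1 hy
  exact mem_geomRealOn_iff.2 ⟨vertexPush_nonneg h1, hT, h3.mono support_vertexPush_subset,
    sum_vertexPush h4⟩

theorem segment_vertexPush_mem [Finite X] {S : Set X} {v : X} {y : X → ℝ} (hy : y ∈ geomRealOn S)
    {t : ℝ} (ht : t ∈ Set.Icc (0 : ℝ) 1) : (1 - t) • y + t • vertexPush v y ∈ geomRealOn S := by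
  have := Fintype.ofFinite X
  obtain ⟨h1, h2, h3, h4⟩ := mem_geomRealOn_iff.1 hy
  exact segment_mem_geomRealOn h3 h2 h1 (vertexPush_nonneg h1) h4 (sum_vertexPush h4) subset_rfl
    support_vertexPush_subset ht

theorem vertexPush_mem_of_le [Finite X] {S : Set X} {v : X} {y : X → ℝ}
    (hy : y ∈ geomRealOn (insert v S)) (hle : y v ≤ 1 / 2) : vertexPush v y ∈ geomRealOn S := by
  refine vertexPush_mem hy fun x hx => ?_
  refine (hy.2.1 (support_vertexPush_subset hx)).resolve_left ?_
  rintro rfl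
  refine hx ?_
  simp only [vertexPush, if_true]
  exact max_eq_left (by linarith)

theorem vertexPush_mem_of_pos [Finite X] {S : Set X} {v : X} {y : X → ℝ}
    (hy : y ∈ geomRealOn (insert v S)) (hpos : 0 < y v) :
    vertexPush v y ∈ geomRealOn (insert v (posetLink v S)) := by
  refine vertexPush_mem hy fun x hx => ?_
  have hx' := support_vertexPush_subset hx
  by_cases h : x = v
  · exact Or.inl h
  · refine Or.inr ⟨(hy.2.1 hx').resolve_left h, ?_⟩
    exact (hy.2.2.1 hx' hpos.ne' h).imp (fun hle => lt_of_le_of_ne hle h)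
      (fun hle => lt_of_le_of_ne hle (Ne.symm h))

theorem IsGridded.exists_homotopy_vertexPush [Finite X] {S : Set X} {v : X} (hv : v ∉ S) {k : ℕ}
    (hL : ExtendsBelow k (geomRealOn (posetLink v S))) {ι : Type} [Fintype ι] {D D' : Set (ι → ℝ)}
    (hD : IsGridded k D D') (hDc : IsCompact D) {f : (ι → ℝ) → X → ℝ}
    (hf : ContinuousOn f D) (hfS : Set.MapsTo f D (geomRealOn (insert v S)))
    (hf' : Set.MapsTo f D' (geomRealOn S)) :
    ∃ h : ℝ × (ι → ℝ) → X → ℝ, ContinuousOn h (Set.Icc 0 1 ×ˢ D) ∧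
      Set.MapsTo h (Set.Icc 0 1 ×ˢ D) (geomRealOn (insert v S)) ∧
      (∀ x ∈ D, h (0, x) = vertexPush v (f x)) ∧ (∀ x ∈ D, h (1, x) ∈ geomRealOn S) ∧
      ∀ x ∈ D', ∀ t ∈ Set.Icc (0 : ℝ) 1, h (t, x) = f x := by
  have hfix : ∀ x ∈ D', vertexPush v (f x) = f x := fun x hx =>
    vertexPush_eq_self (apply_eq_zero_of_mem_geomRealOn hv (hf' hx))
  have hlink : posetLink v S ⊆ S := fun x hx => hx.1
  obtain ⟨h, h1, h2, h3, h4, h5⟩ := hD.exists_homotopy hDc (A := geomRealOn S)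
    (B := geomRealOn (insert v (posetLink v S))) hL
    (extendsBelow_geomRealOn_of_comparable (v := v) (Set.mem_insert _ _) (by
      rintro x (rfl | hx)
      · exact Or.inl le_rfl
      · exact hx.2.imp le_of_lt le_of_lt))
    (geomRealOn_mono hlink) (geomRealOn_mono (Set.subset_insert _ _))
    (fun y hy => ⟨hy.1.1, fun x hx => (hy.2.2.1 hx).resolve_left (by
      rintro rfl
      exact hv (hy.1.2.1 hx)), hy.1.2.2⟩)
    (f := fun x => vertexPush v (f x)) ((continuous_vertexPush v).comp_continuousOn hf)
    (r := fun x => f x v) ((continuous_apply v).comp_continuousOn hf)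
    (fun x hx => vertexPush_mem_of_le (hfS hx)) (fun x hx => vertexPush_mem_of_pos (hfS hx))
    (fun x hx => by simp only [hfix x hx]; exact hf' hx)
  refine ⟨h, h1, fun q hq => ?_, h3, h4, fun x hx t ht => (h5 x hx t ht).trans (hfix x hx)⟩
  rcases h2 hq with h | h
  · exact geomRealOn_mono (Set.subset_insert _ _) h
  · exact geomRealOn_mono (Set.insert_subset_insert hlink) h

/-- Attaching a cone over a highly connected link preserves high connectivity. -/
theorem ExtendsBelow.insert [Finite X] {S : Set X} {v : X} (hv : v ∉ S) {k : ℕ}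
    (hL : ExtendsBelow k (geomRealOn (posetLink v S))) (hS : ExtendsBelow (k + 1) (geomRealOn S)) :
    ExtendsBelow (k + 1) (geomRealOn (insert v S)) := by
  intro ι _ hι g hg hgS
  obtain ⟨h, h1, h2, h3, h4, -⟩ := (isGridded_unitBoxBd ι).exists_homotopy_vertexPush hv
    (hL.mono (Nat.lt_succ_iff.1 hι)) (isCompact_unitBoxBd ι) hg hgS
    (Set.mapsTo_empty _ _)
  obtain ⟨G, hG, hGS, hGe⟩ := hS ι hι (fun x => h (1, x))
    (h1.comp (by fun_prop) fun x hx => ⟨by simp, hx⟩) h4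
  obtain ⟨G', hG', hGS', hGe'⟩ := exists_extension_of_homotopy h1 h2 h3
    (fun x hx => (hGe hx).symm) hG (hGS.mono_right (geomRealOn_mono (Set.subset_insert _ _)))
  refine exists_extension_of_homotopy (G := G')
    (H := fun q => (1 - q.1) • g q.2 + q.1 • vertexPush v (g q.2)) ?_
    (fun q hq => segment_vertexPush_mem (hgS hq.2) hq.1) (by simp)
    (fun x hx => by simp [hGe' hx]) hG' hGS'
  have h1 : ContinuousOn (fun q : ℝ × (ι → ℝ) => g q.2) (Set.Icc 0 1 ×ˢ unitBoxBd ι) :=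
    hg.comp continuous_snd.continuousOn fun q hq => hq.2
  have h2 := (continuous_vertexPush v).comp_continuousOn h1
  exact ((by fun_prop : ContinuousOn (fun q : ℝ × (ι → ℝ) => 1 - q.1) _).smul h1).add
    (continuousOn_fst.smul h2)

end OrderComplex

section HomotopyGroups

open unitInterval

theorem homotopicRel_of_continuousOn {E : Type*} [TopologicalSpace E] {B : Set E} {ι : Type*}
    {q₀ q₁ : C(ι → I, ↥B)} {h : ℝ × (ι → ℝ) → E}
    (hc : ContinuousOn h (Set.Icc 0 1 ×ˢ unitBox ι))
    (hB : Set.MapsTo h (Set.Icc 0 1 ×ˢ unitBox ι) B)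
    (h0 : ∀ y : ι → I, h (0, fun i => y i) = q₀ y) (h1 : ∀ y : ι → I, h (1, fun i => y i) = q₁ y)
    (hbd : ∀ y ∈ Cube.boundary ι, ∀ t ∈ Set.Icc (0 : ℝ) 1, h (t, fun i => y i) = q₀ y) :
    q₀.HomotopicRel q₁ (Cube.boundary ι) := by
  have hmem : ∀ p : I × (ι → I),
      ((p.1, fun i => p.2 i) : ℝ × (ι → ℝ)) ∈ Set.Icc (0 : ℝ) 1 ×ˢ unitBox ι :=
    fun p => ⟨p.1.2, fun i => (p.2 i).2⟩
  exact ⟨{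
    toFun := fun p => ⟨h (p.1, fun i => p.2 i), hB (hmem p)⟩
    continuous_toFun := (hc.comp_continuous (by fun_prop) hmem).subtype_mk _
    map_zero_left := fun y => Subtype.ext (by simpa using h0 y)
    map_one_left := fun y => Subtype.ext (by simpa using h1 y)
    prop' := fun t y hy => Subtype.ext (hbd y hy t t.2) }⟩

/-- The retraction of `ι → ℝ` onto the unit cube. -/
noncomputable def toCube {ι : Type*} (x : ι → ℝ) : ι → I :=
  fun i => Set.projIcc 0 1 zero_le_one (x i)

theorem continuous_toCube {ι : Type*} : Continuous (toCube : (ι → ℝ) → ι → I) :=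
  continuous_pi fun i => continuous_projIcc.comp (continuous_apply i)

theorem toCube_coe {ι : Type*} (y : ι → I) : toCube (fun i => (y i : ℝ)) = y :=
  funext fun i => Set.projIcc_val zero_le_one (y i)

theorem toCube_mem_boundary {ι : Type*} {x : ι → ℝ} (hx : ∃ i, x i = 0 ∨ x i = 1) :
    toCube x ∈ Cube.boundary ι := by
  obtain ⟨i, hi | hi⟩ := hx
  · exact ⟨i, Or.inl (by simp [toCube, hi])⟩
  · exact ⟨i, Or.inr (by simp [toCube, hi])⟩

theorem coe_mem_unitBoxBd {ι : Type*} {y : ι → I} (hy : y ∈ Cube.boundary ι) :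
    (fun i => (y i : ℝ)) ∈ unitBoxBd ι := by
  obtain ⟨i, hi⟩ := hy
  exact ⟨fun i => (y i).2, i, hi.imp (by simp +contextual) (by simp +contextual)⟩

variable {X : Type*} [PartialOrder X] {S T : Set X} {v : X} {n : ℕ}

theorem inducedPiMap_geomRealIncl_trans {U : Set X} (hST : S ⊆ T) (hTU : T ⊆ U) (N : Type*)
    (a : ↥(geomRealOn S)) :
    inducedPiMap N (geomRealIncl (hST.trans hTU)) a =
      inducedPiMap N (geomRealIncl hTU) (geomRealIncl hST a) ∘
        inducedPiMap N (geomRealIncl hST) a := by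
  funext c
  induction c using Quotient.inductionOn
  rfl

theorem inducedPiMap_geomRealIncl_rfl (N : Type*) (a : ↥(geomRealOn S)) :
    inducedPiMap N (geomRealIncl (subset_refl S)) a = id := by
  funext c
  induction c using Quotient.inductionOn
  rfl

theorem IsNEquivalence.geomRealIncl_trans {U : Set X} {hST : S ⊆ T} {hTU : T ⊆ U}
    (h₁ : IsNEquivalence (geomRealIncl hST) n) (h₂ : IsNEquivalence (geomRealIncl hTU) n) :
    IsNEquivalence (geomRealIncl (hST.trans hTU)) n := fun a => by
  simp only [inducedPiMap_geomRealIncl_trans hST hTU]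
  exact ⟨fun i hi => ((h₂ _).1 i hi).comp ((h₁ a).1 i hi), (h₂ _).2.comp (h₁ a).2⟩

variable [Finite X]

theorem surjective_inducedPiMap_insert (hv : v ∉ S)
    (hL : ExtendsBelow (n + 1) (geomRealOn (posetLink v S))) (a : ↥(geomRealOn S)) {i : ℕ}
    (hi : i ≤ n) :
    Function.Surjective (inducedPiMap (Fin i) (geomRealIncl (Set.subset_insert v S)) a) := by
  intro c
  induction c using Quotient.inductionOn with | _ q
  set f : (Fin i → ℝ) → X → ℝ := fun x => (q.1 (toCube x)).1 with hf
  have hfc : Continuous f :=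
    continuous_subtype_val.comp (q.1.continuous.comp continuous_toCube)
  have hfbd : ∀ x ∈ unitBoxBd (Fin i), f x = a.1 := fun x hx =>
    congrArg Subtype.val (q.2 _ (toCube_mem_boundary hx.2))
  have hfy : ∀ y : Fin i → I, f (fun j => y j) = (q.1 y).1 := fun y => by
    rw [hf]; simp only [toCube_coe]
  have hfm : ∀ x, f x ∈ geomRealOn (insert v S) := fun x => (q.1 _).2
  obtain ⟨h, h1, h2, h3, h4, h5⟩ := (isGridded_unitBox (Fin i)).exists_homotopy_vertexPush hv
    (hL.mono (by simpa using hi)) (isCompact_unitBox _) hfc.continuousOn (fun x _ => hfm x)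
    (fun x hx => by rw [hfbd x hx]; exact a.2)
  have hbox : ∀ y : Fin i → I, (fun j => (y j : ℝ)) ∈ unitBox (Fin i) := fun y j => (y j).2
  have hone : (1 : ℝ) ∈ Set.Icc (0 : ℝ) 1 := by simp
  let p : GenLoop (Fin i) ↥(geomRealOn S) a :=
    ⟨⟨fun y => ⟨h (1, fun j => y j), h4 _ (hbox y)⟩,
      (h1.comp_continuous (by fun_prop) fun y => ⟨hone, hbox y⟩).subtype_mk _⟩,
      fun y hy => Subtype.ext ((h5 _ (coe_mem_unitBoxBd hy) 1 hone).trans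
        (hfbd _ (coe_mem_unitBoxBd hy)))⟩
  let m : C(Fin i → I, ↥(geomRealOn (insert v S))) :=
    ⟨fun y => ⟨h (0, fun j => y j), h2 ⟨by simp, hbox y⟩⟩,
      (h1.comp_continuous (by fun_prop) fun y => ⟨by simp, hbox y⟩).subtype_mk _⟩
  refine ⟨⟦p⟧, Quotient.sound ?_⟩
  have hm : m.HomotopicRel (genLoopMap (Fin i) (geomRealIncl (Set.subset_insert v S)) a p).1
      (Cube.boundary (Fin i)) :=
    homotopicRel_of_continuousOn h1 h2 (fun y => rfl) (fun y => rfl) fun y hy t ht =>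
      (h5 _ (coe_mem_unitBoxBd hy) t ht).trans (h5 _ (coe_mem_unitBoxBd hy) 0 (by simp)).symm
  have hqm : q.1.HomotopicRel m (Cube.boundary (Fin i)) := by
    refine homotopicRel_of_continuousOn
      (h := fun x => (1 - x.1) • f x.2 + x.1 • vertexPush v (f x.2)) ?_
      (fun x hx => segment_vertexPush_mem (hfm _) hx.1) (fun y => by simp [hfy])
      (fun y => by simp [m, h3 _ (hbox y)]) fun y hy t ht => ?_
    · have := (continuous_vertexPush v).comp hfc
      exact (((by fun_prop : Continuous fun x : ℝ × (Fin i → ℝ) => 1 - x.1).smul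
        (hfc.comp continuous_snd)).add
        (continuous_fst.smul (this.comp continuous_snd))).continuousOn
    · have hfix : vertexPush v (f fun j => y j) = f fun j => y j := by
        rw [hfbd _ (coe_mem_unitBoxBd hy)]
        exact vertexPush_eq_self (apply_eq_zero_of_mem_geomRealOn hv a.2)
      change (1 - t) • f _ + t • vertexPush v (f _) = _
      rw [hfix, ← add_smul, sub_add_cancel, one_smul, hfy]
  exact (hqm.trans hm).symm

theorem injective_inducedPiMap_insert (hv : v ∉ S)
    (hL : ExtendsBelow (n + 1) (geomRealOn (posetLink v S))) (a : ↥(geomRealOn S)) {i : ℕ}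
    (hi : i < n) :
    Function.Injective (inducedPiMap (Fin i) (geomRealIncl (Set.subset_insert v S)) a) := by
  intro c₀ c₁ hc
  induction c₀ using Quotient.inductionOn with | _ p₀
  induction c₁ using Quotient.inductionOn with | _ p₁
  obtain ⟨F⟩ := Quotient.exact hc
  set f : (Option (Fin i) → ℝ) → X → ℝ :=
    fun x => (F (Set.projIcc 0 1 zero_le_one (x none), toCube fun j => x (some j))).1 with hf
  have hfc : Continuous f := continuous_subtype_val.comp (F.continuous.comp
    ((continuous_projIcc.comp (continuous_apply none)).prodMk
      (continuous_toCube.comp (by fun_prop))))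
  have hf0 : ∀ x : Option (Fin i) → ℝ, x none = 0 →
      f x = (p₀.1 (toCube fun j => x (some j))).1 := fun x hx => by
    simp only [hf, hx, Set.projIcc_left]
    exact congrArg Subtype.val (F.apply_zero _)
  have hf1 : ∀ x : Option (Fin i) → ℝ, x none = 1 →
      f x = (p₁.1 (toCube fun j => x (some j))).1 := fun x hx => by
    simp only [hf, hx, Set.projIcc_right]
    exact congrArg Subtype.val (F.apply_one _)
  have hfs : ∀ x : Option (Fin i) → ℝ, (∃ j, x (some j) = 0 ∨ x (some j) = 1) →
      f x = (p₀.1 (toCube fun j => x (some j))).1 := fun x hx =>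
    congrArg Subtype.val (F.eq_fst _ (toCube_mem_boundary hx))
  obtain ⟨h, h1, h2, h3, h4, h5⟩ :=
    (isGridded_unitBox (Option (Fin i))).exists_homotopy_vertexPush hv
    (hL.mono (by simp; omega)) (isCompact_unitBox _) hfc.continuousOn
    (fun x _ => (F _).2) (fun x hx => by
      obtain ⟨-, (_ | j), hj⟩ := hx
      · rcases hj with hj | hj
        · rw [hf0 x hj]; exact (p₀.1 _).2
        · rw [hf1 x hj]; exact (p₁.1 _).2
      · rw [hfs x ⟨j, hj⟩]; exact (p₀.1 _).2)
  let e : ℝ × (Fin i → ℝ) → Option (Fin i) → ℝ := fun x j => j.elim x.1 x.2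
  have he : Continuous e := continuous_pi fun j => by
    cases j
    · exact continuous_fst
    · exact (continuous_apply _).comp continuous_snd
  have hem : ∀ x ∈ Set.Icc (0 : ℝ) 1 ×ˢ unitBox (Fin i), e x ∈ unitBox (Option (Fin i)) := by
    rintro x ⟨hx1, hx2⟩ (_ | j)
    · exact hx1
    · exact hx2 j
  have hbox : ∀ y : Fin i → I, (fun j => (y j : ℝ)) ∈ unitBox (Fin i) := fun y j => (y j).2
  refine Quotient.sound (homotopicRel_of_continuousOn (h := fun x => h (1, e x))
    (h1.comp (by fun_prop) fun x hx => ⟨by simp, hem x hx⟩) (fun x hx => h4 _ (hem x hx))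
    (fun y => ?_) (fun y => ?_) fun y hy t ht => ?_)
  · rw [h5 _ ⟨hem _ ⟨by simp, hbox y⟩, none, Or.inl rfl⟩ 1 (by simp), hf0 _ rfl]
    exact congrArg (fun z => (p₀.1 z).1) (toCube_coe y)
  · rw [h5 _ ⟨hem _ ⟨by simp, hbox y⟩, none, Or.inr rfl⟩ 1 (by simp), hf1 _ rfl]
    exact congrArg (fun z => (p₁.1 z).1) (toCube_coe y)
  · obtain ⟨-, j, hj⟩ := coe_mem_unitBoxBd hy
    rw [h5 (e (t, fun j => y j)) ⟨hem _ ⟨ht, hbox y⟩, some j, hj⟩ 1 (by simp), hfs _ ⟨j, hj⟩]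
    exact congrArg (fun z => (p₀.1 z).1) (toCube_coe y)

theorem isNEquivalence_insert (hv : v ∉ S)
    (hL : ExtendsBelow (n + 1) (geomRealOn (posetLink v S))) :
    IsNEquivalence (geomRealIncl (Set.subset_insert v S)) n := fun a =>
  ⟨fun _ hi => ⟨injective_inducedPiMap_insert hv hL a hi,
    surjective_inducedPiMap_insert hv hL a hi.le⟩, surjective_inducedPiMap_insert hv hL a le_rfl⟩

/-- Adding to a finite poset pairwise incomparable elements with highly connected links. -/
theorem isNEquivalence_geomRealIncl (hST : S ⊆ T)
    (hanti : ∀ v ∈ T, v ∉ S → ∀ w ∈ T, w ∉ S → ¬ v < w)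
    (hL : ∀ v ∈ T, v ∉ S → ExtendsBelow (n + 1) (geomRealOn (posetLink v S))) :
    IsNEquivalence (geomRealIncl hST) n := by
  have key : ∀ R : Set X, R.Finite → ∀ U : Set X, R ⊆ T \ S → U = S ∪ R →
      ∀ hSU : S ⊆ U, IsNEquivalence (geomRealIncl hSU) n := by
    intro R hR
    induction R, hR using Set.Finite.induction_on with
    | empty =>
      rintro U - rfl hSU
      revert hSU
      rw [Set.union_empty]
      intro _ a
      simp only [inducedPiMap_geomRealIncl_rfl]
      exact ⟨fun _ _ => Function.bijective_id, Function.surjective_id⟩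
    | @insert v R hvR _ ih =>
      rintro U hR hU hSU
      rw [Set.union_insert] at hU
      subst hU
      have hvT := hR (Set.mem_insert v R)
      have hRT := (Set.subset_insert v R).trans hR
      have h₁ := ih (S ∪ R) hRT rfl Set.subset_union_left
      have hlink : posetLink v (S ∪ R) = posetLink v S := by
        ext x
        refine ⟨fun hx => ⟨hx.1.resolve_right fun hxR => ?_, hx.2⟩, fun hx => ⟨Or.inl hx.1, hx.2⟩⟩
        exact hx.2.elim (hanti x (hRT hxR).1 (hRT hxR).2 v hvT.1 hvT.2)
          (hanti v hvT.1 hvT.2 x (hRT hxR).1 (hRT hxR).2)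
      have h₂ := isNEquivalence_insert (n := n) (v := v) (S := S ∪ R)
        (fun h => h.elim hvT.2 hvR) (by rw [hlink]; exact hL v hvT.1 hvT.2)
      exact h₁.geomRealIncl_trans h₂
  exact key (T \ S) (Set.toFinite _) T subset_rfl (Set.union_sdiff_cancel hST).symm hST

end HomotopyGroups

open scoped Pointwise in
theorem Subgroup.card_sup_le_of_commute {G : Type*} [Group G] {H Z : Subgroup G}
    (h : ∀ z ∈ Z, ∀ g ∈ H, z * g = g * z) :
    Nat.card ↥(H ⊔ Z) ≤ Nat.card ↥H * Nat.card ↥Z := by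
  have hle : Z ≤ Subgroup.normalizer (H : Set G) := fun z hz =>
    Subgroup.mem_normalizer_iff.2 fun g => by
      constructor
      · intro hg
        rwa [h z hz g hg, mul_inv_cancel_right]
      · intro hg
        have := h z hz _ hg
        rw [inv_mul_cancel_right] at this
        rwa [mul_left_cancel this] at hg
  have := Subgroup.coe_mul_of_right_le_normalizer_left H Z hle
  calc Nat.card ↥(H ⊔ Z) = Nat.card ↥((H : Set G) * (Z : Set G) : Set G) := by
        rw [← this]; rfl
    _ ≤ _ := Set.natCard_mul_le

section SubgroupPosets

variable {G : Type*} [Group G] [Finite G] {p : ℕ} [hp : Fact p.Prime]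

theorem exists_central_subgroup_card_eq {P : Subgroup G} {k : ℕ}
    (hP : Nat.card ↥P = p ^ (k + 1)) :
    ∃ Z ≤ P, Nat.card ↥Z = p ∧ ∀ z ∈ Z, ∀ g ∈ P, z * g = g * z := by
  have hPp : IsPGroup p ↥P := IsPGroup.of_card hP
  have : Nontrivial ↥P := Finite.one_lt_card_iff_nontrivial.1 (by
    rw [hP]; exact Nat.one_lt_pow (by omega) hp.out.one_lt)
  have := hPp.center_nontrivial
  have hdvd : p ∣ Nat.card ↥(Subgroup.center ↥P) :=
    (hPp.to_subgroup _).card_eq_or_dvd.resolve_left Finite.one_lt_card.ne'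
  obtain ⟨z, hz⟩ := exists_prime_orderOf_dvd_card' p hdvd
  refine ⟨Subgroup.zpowers ((z : ↥P) : G), Subgroup.zpowers_le.2 (z : ↥P).2, ?_, ?_⟩
  · rw [Nat.card_zpowers, Subgroup.orderOf_coe, Subgroup.orderOf_coe, hz]
  · rintro _ ⟨m, rfl⟩ g hg
    have h1 : Commute ((z : ↥P) : G) g :=
      (congrArg Subtype.val (Subgroup.mem_center_iff.1 z.2 ⟨g, hg⟩)).symm
    exact (h1.zpow_left m).eq

/-- The poset of proper nontrivial subgroups of a group of order `p ^ (k + 1)` is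
`(k - 2)`-connected. -/
theorem extendsBelow_properSubgroups (k : ℕ) (P : Subgroup G) (hP : Nat.card ↥P = p ^ (k + 1)) :
    ExtendsBelow k (geomRealOn {H : Subgroup G | H ≠ ⊥ ∧ H < P}) := by
  classical
  induction k generalizing P with
  | zero => exact fun ι _ hι => absurd hι (Nat.not_lt_zero _)
  | succ k ih =>
    obtain ⟨Z, hZP, hZ, hcomm⟩ := exists_central_subgroup_card_eq hP
    have hZlt : Z < P := lt_of_le_of_ne hZP fun h => by
      rw [← h, hZ] at hP
      exact (lt_self_pow₀ hp.out.one_lt (by omega)).ne hP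
    have hZne : Z ≠ ⊥ := by
      rintro rfl
      rw [Subgroup.card_bot] at hZ
      exact hp.out.one_lt.ne hZ
    set S₀ : Set (Subgroup G) := {H | H < P ∧ Z ≤ H} with hS₀
    have hbase : ExtendsBelow (k + 2) (geomRealOn S₀) :=
      extendsBelow_geomRealOn_of_comparable (v := Z) (C := S₀) ⟨hZlt, le_rfl⟩
        (fun H hH => Or.inr hH.2) _
    have key : ∀ R : Finset (Subgroup G), (∀ H ∈ R, H ≠ ⊥ ∧ H < P ∧ ¬ Z ≤ H) →
        (∀ H ∈ R, ∀ K ≤ H, K ≠ ⊥ → K ∈ R) → ExtendsBelow (k + 1) (geomRealOn (S₀ ∪ ↑R)) := by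
      intro R
      induction R using Finset.induction_on_max_value (fun H : Subgroup G => Nat.card ↥H) with
      | empty =>
        intro _ _
        rw [Finset.coe_empty, Set.union_empty]
        exact hbase.mono (by omega)
      | insert a s ha hmax ihs =>
        intro hR hdown
        obtain ⟨hane, haP, haZ⟩ := hR a (Finset.mem_insert_self a s)
        have hs : ExtendsBelow (k + 1) (geomRealOn (S₀ ∪ ↑s)) := by
          refine ihs (fun H hH => hR H (Finset.mem_insert_of_mem hH)) fun H hH K hKH hK => ?_
          refine (Finset.mem_insert.1 (hdown H (Finset.mem_insert_of_mem hH) K hKH hK)).resolve_left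
            ?_
          rintro rfl
          rw [Subgroup.eq_of_le_of_card_ge hKH (hmax H hH)] at ha
          exact ha hH
        have hlink : ∀ K ∈ posetLink a (S₀ ∪ ↑s), (K < P ∧ Z ≤ K ∧ a < K) ∨ (K ≠ ⊥ ∧ K < a) := by
          rintro K ⟨hK | hK, hKa | hKa⟩
          · exact absurd (hK.2.trans hKa.le) haZ
          · exact Or.inl ⟨hK.1, hK.2, hKa⟩
          · exact Or.inr ⟨(hR K (Finset.mem_insert_of_mem hK)).1, hKa⟩
          · rw [Subgroup.eq_of_le_of_card_ge hKa.le (hmax K hK)] at ha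
            exact absurd hK ha
        have hlink' : ∀ K : Subgroup G, K ≠ ⊥ → K < a → K ∈ posetLink a (S₀ ∪ ↑s) :=
          fun K hK hKa => ⟨Or.inr ((Finset.mem_insert.1
            (hdown a (Finset.mem_insert_self a s) K hKa.le hK)).resolve_left hKa.ne), Or.inl hKa⟩
        rw [Finset.coe_insert, Set.union_insert]
        refine ExtendsBelow.insert (fun h => h.elim (fun h => haZ h.2) ha) ?_ hs
        by_cases haZP : a ⊔ Z = P
        · have hcard : Nat.card ↥a = p ^ (k + 1) := by
            obtain ⟨j, hj, hja⟩ := (Nat.dvd_prime_pow hp.out).1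
              (hP ▸ Subgroup.card_dvd_of_le haP.le)
            have h1 := Subgroup.card_sup_le_of_commute (H := a) (Z := Z)
              fun z hz g hg => hcomm z hz g (haP.le hg)
            rw [haZP, hP, hja, hZ, ← pow_succ, Nat.pow_le_pow_iff_right hp.out.one_lt] at h1
            have h2 : j ≠ k + 1 + 1 := by
              rintro rfl
              exact haP.ne (Subgroup.eq_of_le_of_card_ge haP.le (by rw [hP, hja]))
            rw [hja, show j = k + 1 by omega]
          have heq : posetLink a (S₀ ∪ ↑s) = {H : Subgroup G | H ≠ ⊥ ∧ H < a} := by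
            ext K
            refine ⟨fun hK => (hlink K hK).resolve_left fun h => ?_, fun hK => hlink' K hK.1 hK.2⟩
            exact h.1.not_ge (haZP ▸ sup_le h.2.2.le h.2.1)
          rw [heq]
          exact ih a hcard
        · refine extendsBelow_geomRealOn_of_comparable (v := a ⊔ Z)
            (C := posetLink a (S₀ ∪ ↑s))
            ⟨Or.inl ⟨lt_of_le_of_ne (sup_le haP.le hZP) haZP, le_sup_right⟩,
              Or.inr (left_lt_sup.2 haZ)⟩ (fun K hK => ?_) k
          exact (hlink K hK).symm.imp (fun h => h.2.le.trans le_sup_left)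
            fun h => sup_le h.2.2.le h.2.1
    have hfin := Set.toFinite {H : Subgroup G | H ≠ ⊥ ∧ H < P ∧ ¬ Z ≤ H}
    have := key hfin.toFinset (fun H hH => hfin.mem_toFinset.1 hH) fun H hH K hKH hK =>
      hfin.mem_toFinset.2 ⟨hK, hKH.trans_lt (hfin.mem_toFinset.1 hH).2.1,
        fun h => (hfin.mem_toFinset.1 hH).2.2 (h.trans hKH)⟩
    rw [hfin.coe_toFinset] at this
    convert this using 2
    ext H
    refine ⟨fun h => ?_, fun h => ?_⟩
    · by_cases hZH : Z ≤ H
      · exact Or.inl ⟨h.2, hZH⟩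
      · exact Or.inr ⟨h.1, h.2, hZH⟩
    · rcases h with h | h
      · exact ⟨fun hb => hZne (le_bot_iff.1 (hb ▸ h.2)), h.1⟩
      · exact ⟨h.1, h.2.1⟩

/-- For a family of `p`-subgroups closed under nontrivial subgroups, adding the members of order
`p ^ (n + 2)` to those of order at most `p ^ (n + 1)` is an `n`-equivalence. -/
theorem isNEquivalence_of_hereditary {F S T : Set (Subgroup G)} (n : ℕ)
    (hbot : ∀ H ∈ F, H ≠ ⊥) (hpg : ∀ H ∈ F, IsPGroup p ↥H)
    (hher : ∀ H ∈ F, ∀ K ≤ H, K ≠ ⊥ → K ∈ F)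
    (hS : S = {H | H ∈ F ∧ Nat.card ↥H ≤ p ^ (n + 1)})
    (hT : T = {H | H ∈ F ∧ Nat.card ↥H ≤ p ^ (n + 1 + 1)}) (hST : S ⊆ T) :
    IsNEquivalence (geomRealIncl hST) n := by
  have hcard : ∀ v ∈ T, v ∉ S → Nat.card ↥v = p ^ (n + 1 + 1) := by
    intro v hv hvS
    subst hS hT
    obtain ⟨j, hj⟩ := IsPGroup.iff_card.1 (hpg v hv.1)
    have h1 := hv.2
    have h2 : ¬ Nat.card ↥v ≤ p ^ (n + 1) := fun h => hvS ⟨hv.1, h⟩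
    rw [hj, Nat.pow_le_pow_iff_right hp.out.one_lt] at h1 h2
    rw [hj, show j = n + 1 + 1 by omega]
  refine isNEquivalence_geomRealIncl hST (fun v hv hvS w hw hwS hvw => ?_) fun v hv hvS => ?_
  · exact hvw.ne (Subgroup.eq_of_le_of_card_ge hvw.le (by rw [hcard v hv hvS, hcard w hw hwS]))
  · have hvc := hcard v hv hvS
    have : posetLink v S = {H : Subgroup G | H ≠ ⊥ ∧ H < v} := by
      subst hS hT
      ext K
      refine ⟨fun hK => ⟨hbot K hK.1.1, hK.2.resolve_right fun h => ?_⟩, fun hK => ?_⟩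
      · have h1 := (Subgroup.card_le_of_le h.le).trans hK.1.2
        rw [hvc, Nat.pow_le_pow_iff_right hp.out.one_lt] at h1
        omega
      · have hKF := hher v hv.1 K hK.2.le hK.1
        refine ⟨⟨hKF, ?_⟩, Or.inl hK.2⟩
        obtain ⟨j, hj⟩ := IsPGroup.iff_card.1 (hpg K hKF)
        have h1 : Nat.card ↥K < Nat.card ↥v := lt_of_not_ge fun h =>
          hK.2.ne (Subgroup.eq_of_le_of_card_ge hK.2.le h)
        rw [hvc, hj, Nat.pow_lt_pow_iff_right hp.out.one_lt] at h1
        rw [hj, Nat.pow_le_pow_iff_right hp.out.one_lt]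
        omega
    rw [this]
    exact extendsBelow_properSubgroups (n + 1) v hvc

theorem bijective_inducedPiMap_of_hereditary {F S : Set (Subgroup G)}
    (hbot : ∀ H ∈ F, H ≠ ⊥) (hpg : ∀ H ∈ F, IsPGroup p ↥H)
    (hher : ∀ H ∈ F, ∀ K ≤ H, K ≠ ⊥ → K ∈ F) (n : ℕ)
    (hS : S = {H | H ∈ F ∧ Nat.card ↥H ≤ p ^ (n + 1)}) (hSF : S ⊆ F) {i : ℕ} (hi : i < n)
    (x : ↥(geomRealOn S)) : Function.Bijective (inducedPiMap (Fin i) (geomRealIncl hSF) x) := by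
  have key : ∀ m : ℕ, ∀ T : Set (Subgroup G),
      T = {H | H ∈ F ∧ Nat.card ↥H ≤ p ^ (n + m + 1)} → ∀ hST : S ⊆ T,
        Function.Bijective (inducedPiMap (Fin i) (geomRealIncl hST) x) := by
    intro m
    induction m with
    | zero =>
      intro T hT hST
      obtain rfl : T = S := hT.trans hS.symm
      rw [inducedPiMap_geomRealIncl_rfl]
      exact Function.bijective_id
    | succ m ih =>
      intro T hT hST
      have hSU : S ⊆ {H | H ∈ F ∧ Nat.card ↥H ≤ p ^ (n + m + 1)} := by
        rw [hS]
        exact fun H hH => ⟨hH.1, hH.2.trans (Nat.pow_le_pow_right hp.out.pos (by omega))⟩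
      have hUT : {H | H ∈ F ∧ Nat.card ↥H ≤ p ^ (n + m + 1)} ⊆ T := by
        rw [hT]
        exact fun H hH => ⟨hH.1, hH.2.trans (Nat.pow_le_pow_right hp.out.pos (by omega))⟩
      rw [inducedPiMap_geomRealIncl_trans hSU hUT]
      exact ((isNEquivalence_of_hereditary (n + m) hbot hpg hher rfl hT hUT _).1 i (by omega)).comp
        (ih _ rfl hSU)
  refine key (Nat.card G) F (Set.ext fun H => ⟨fun hH => ⟨hH, ?_⟩, fun hH => hH.1⟩) hSF
  calc Nat.card ↥H ≤ Nat.card G := Subgroup.card_le_card_group H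
    _ ≤ n + Nat.card G + 1 := by omega
    _ ≤ p ^ (n + Nat.card G + 1) := (Nat.lt_pow_self hp.out.one_lt).le

end SubgroupPosets

theorem IsElementaryAbelian.isPGroup {p : ℕ} {G : Type*} [Group G]
    (h : IsElementaryAbelian p G) : IsPGroup p G :=
  fun g => ⟨1, by rw [pow_one]; exact h.2 g⟩

theorem isElementaryAbelian_of_le {p : ℕ} {G : Type*} [Group G] {K H : Subgroup G} (hKH : K ≤ H)
    (h : IsElementaryAbelian p ↥H) : IsElementaryAbelian p ↥K :=
  ⟨fun a b => Subtype.ext (Subtype.ext_iff.1 (h.1 ⟨a, hKH a.2⟩ ⟨b, hKH b.2⟩) :),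
    fun a => Subtype.ext (Subtype.ext_iff.1 (h.2 ⟨a, hKH a.2⟩) :)⟩

/-- For a finite group `G`, a prime `p` and `n ≥ 0`, the inclusions
`A_p(G)ⁿ ↪ A_p(G)ⁿ⁺¹` and `S_p(G)ⁿ ↪ S_p(G)ⁿ⁺¹` induce `n`-equivalences of geometric
realizations; in particular the inclusions `A_p(G)² ↪ A_p(G)` and `S_p(G)² ↪ S_p(G)`
induce isomorphisms of fundamental groups at every basepoint. -/
theorem stmt7 (G : Type) [Group G] [Finite G] (p : ℕ) (hp : p.Prime) (n : ℕ) :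
    IsNEquivalence (geomRealIncl (apSetN_subset_succ p G n hp.one_lt.le)) n ∧
    IsNEquivalence (geomRealIncl (spSetN_subset_succ p G n hp.one_lt.le)) n ∧
    (∀ x : ↥(geomRealOn (apSetN p G 2)),
      Function.Bijective (inducedPiMap (Fin 1) (geomRealIncl (apSetN_subset p G 2)) x)) ∧
    (∀ x : ↥(geomRealOn (spSetN p G 2)),
      Function.Bijective (inducedPiMap (Fin 1) (geomRealIncl (spSetN_subset p G 2)) x)) := by
  have : Fact p.Prime := ⟨hp⟩
  have hA : ∀ H ∈ apSet p G, ∀ K ≤ H, K ≠ ⊥ → K ∈ apSet p G := fun H hH K hKH hK =>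
    ⟨hK, isElementaryAbelian_of_le hKH hH.2⟩
  have hS : ∀ H ∈ spSet p G, ∀ K ≤ H, K ≠ ⊥ → K ∈ spSet p G := fun H hH K hKH hK =>
    ⟨hK, hH.2.to_le hKH⟩
  have hAp : ∀ H ∈ apSet p G, IsPGroup p ↥H := fun H hH => hH.2.isPGroup
  exact ⟨isNEquivalence_of_hereditary n (fun H hH => hH.1) hAp hA rfl rfl _,
    isNEquivalence_of_hereditary n (fun H hH => hH.1) (fun H hH => hH.2) hS rfl rfl _,
    bijective_inducedPiMap_of_hereditary (fun H hH => hH.1) hAp hA 2 rfl _ one_lt_two,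
    bijective_inducedPiMap_of_hereditary (fun H hH => hH.1) (fun H hH => hH.2) hS 2 rfl _
      one_lt_two⟩
end

section
/- Let p be a prime, N a finite group of order prime to p, and A an elementary abelian p-group of rank at least 2 acting on N. Then A_p(A ⋉ N) is connected, where A ⋉ N is the corresponding semidirect product. -/
open Function

open scoped Pointwise

/-- The subgroup generated by the centralizers in `N` of the nontrivial elements of `A`. -/
def centralizerSpan (A N : Type*) [Group A] [Group N] [MulDistribMulAction A N] : Subgroup N :=
  Subgroup.closure {x : N | ∃ a : A, a ≠ 1 ∧ a • x = x}

theorem mem_centralizerSpan {A N : Type*} [Group A] [Group N] [MulDistribMulAction A N]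
    {a : A} (ha : a ≠ 1) {x : N} (hx : a • x = x) : x ∈ centralizerSpan A N :=
  Subgroup.subset_closure ⟨a, ha, hx⟩

theorem centralizerSpan_eq_top_of_commGroup {p : ℕ} (hp : p.Prime) {A N : Type*} [Group A]
    [Finite A] [CommGroup N] [MulDistribMulAction A N] (hN : (Nat.card N).Coprime p)
    (hA : IsElementaryAbelian p A) {a b : A} (hb : b ≠ 1) (hab : a ∉ Subgroup.zpowers b) :
    centralizerSpan A N = ⊤ := by
  classical
  have : Fact p.Prime := ⟨hp⟩
  have := Fintype.ofFinite (Subgroup.zpowers b)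
  have hcard : Nat.card (Subgroup.zpowers b) = p := by
    rw [Nat.card_zpowers]
    exact orderOf_eq_prime (hA.2 b) hb
  refine (Subgroup.eq_top_iff' _).2 fun y => ?_
  obtain ⟨x, rfl⟩ := (powCoprime hN).surjective y
  rw [powCoprime_apply]
  have hnorm (z : N) : ∏ c : Subgroup.zpowers b, (c : A) • z ∈ centralizerSpan A N := by
    refine mem_centralizerSpan hb ?_
    rw [Finset.smul_prod']
    refine Fintype.prod_equiv (Equiv.mulLeft ⟨b, Subgroup.mem_zpowers b⟩) _ _ fun c => ?_
    simp [mul_smul]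
  have hline (c : Subgroup.zpowers b) :
      ∏ j ∈ Finset.range p, (a * c) ^ j • x ∈ centralizerSpan A N := by
    refine mem_centralizerSpan (a := a * c) (fun h => hab ?_) ?_
    · rw [eq_inv_of_mul_eq_one_left h]
      exact inv_mem c.2
    · rw [Finset.smul_prod']
      simp_rw [← mul_smul, ← pow_succ']
      have h1 := Finset.prod_range_succ (fun j => (a * c : A) ^ j • x) p
      rw [Finset.prod_range_succ'] at h1
      exact mul_right_cancel (b := x) (by simpa [hA.2] using h1)
  have hswap : ∏ c : Subgroup.zpowers b, ∏ j ∈ Finset.range p, (a * c : A) ^ j • x =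
      (∏ j ∈ Finset.range (p - 1), ∏ c : Subgroup.zpowers b, (c : A) • a ^ (j + 1) • x)
        * x ^ p := by
    rw [Finset.prod_comm]
    conv_lhs => rw [← Nat.sub_add_cancel hp.one_le, Finset.prod_range_succ']
    congr 1
    · refine Finset.prod_congr rfl fun j hj => ?_
      have hj' : (Nat.card (Subgroup.zpowers b)).Coprime (j + 1) := by
        rw [hcard]
        exact (Nat.coprime_of_lt_prime j.succ_ne_zero (by have := Finset.mem_range.1 hj; omega) hp)
      refine Fintype.prod_equiv (powCoprime hj') _ _ fun c => ?_
      rw [powCoprime_apply, Subgroup.coe_pow, ← mul_smul, (show Commute a c from hA.1 _ _).mul_pow,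
        hA.1]
    · simp [← hcard, Nat.card_eq_fintype_card]
  have hmem := prod_mem (S := centralizerSpan A N) (t := Finset.univ) fun c _ => hline c
  rw [hswap] at hmem
  exact (Subgroup.mul_mem_cancel_left _ (prod_mem fun j _ => hnorm _)).1 hmem

/-- The action on an invariant subgroup. -/
abbrev invariantSubgroupAction {A N : Type*} [Group A] [Group N] [MulDistribMulAction A N]
    (H : Subgroup N) (h : ∀ (a : A), ∀ x ∈ H, a • x ∈ H) : MulDistribMulAction A H where
  smul a x := ⟨a • (x : N), h a x x.2⟩
  one_smul x := Subtype.ext (one_smul A (x : N))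
  mul_smul a b x := Subtype.ext (mul_smul a b (x : N))
  smul_mul a x y := Subtype.ext (smul_mul' a (x : N) y)
  smul_one a := Subtype.ext (smul_one a)

/-- The action on the quotient by an invariant normal subgroup. -/
abbrev quotientInvariantAction {A N : Type*} [Group A] [Group N] [MulDistribMulAction A N]
    (H : Subgroup N) [H.Normal] (h : ∀ (a : A), ∀ x ∈ H, a • x ∈ H) :
    MulDistribMulAction A (N ⧸ H) where
  smul a := QuotientGroup.map H H (MulDistribMulAction.toMonoidHom N a) (h a)
  one_smul x := by
    induction x using QuotientGroup.induction_on with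
    | H x => exact congrArg QuotientGroup.mk (one_smul A x)
  mul_smul a b x := by
    induction x using QuotientGroup.induction_on with
    | H x => exact congrArg QuotientGroup.mk (mul_smul a b x)
  smul_mul a x y := map_mul (QuotientGroup.map H H (MulDistribMulAction.toMonoidHom N a) (h a)) x y
  smul_one a := map_one (QuotientGroup.map H H (MulDistribMulAction.toMonoidHom N a) (h a))

theorem le_centralizerSpan_of_invariant {A N : Type*} [Group A] [Group N]
    [MulDistribMulAction A N] {H : Subgroup N} (h : ∀ (a : A), ∀ x ∈ H, a • x ∈ H)
    (hH : @centralizerSpan A H _ _ (invariantSubgroupAction H h) = ⊤) :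
    H ≤ centralizerSpan A N := by
  let := invariantSubgroupAction H h
  have hle : centralizerSpan A H ≤ (centralizerSpan A N).comap H.subtype :=
    (Subgroup.closure_le _).2 fun x ⟨a, ha, hx⟩ =>
      mem_centralizerSpan ha (congrArg Subtype.val hx)
  intro x hx
  exact hle (hH ▸ Subgroup.mem_top (⟨x, hx⟩ : H))

/-- In a coprime action, an invariant coset of an invariant normal subgroup contains
a fixed point. -/
theorem exists_smul_eq_of_quotient {p : ℕ} (hp : p.Prime) {A N : Type*} [Group A]
    [Group N] [Finite N] [MulDistribMulAction A N] (hN : (Nat.card N).Coprime p)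
    (hA : IsElementaryAbelian p A) {H : Subgroup N} [H.Normal]
    (h : ∀ (a : A), ∀ x ∈ H, a • x ∈ H) {a : A} {x : N}
    (hx : (QuotientGroup.mk (a • x) : N ⧸ H) = QuotientGroup.mk x) :
    ∃ y : N, (QuotientGroup.mk y : N ⧸ H) = QuotientGroup.mk x ∧ a • y = y := by
  have : Fact p.Prime := ⟨hp⟩
  let := quotientInvariantAction H h
  have hstab : Subgroup.zpowers a ≤ MulAction.stabilizer A (QuotientGroup.mk x : N ⧸ H) :=
    Subgroup.zpowers_le.2 hx
  let S := {y : N // (QuotientGroup.mk y : N ⧸ H) = QuotientGroup.mk x}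
  let : MulAction (Subgroup.zpowers a) S :=
    { smul c y := ⟨(c : A) • (y : N), (congrArg ((c : A) • ·) y.2).trans (hstab c.2)⟩
      one_smul y := Subtype.ext (one_smul A (y : N))
      mul_smul c d y := Subtype.ext (mul_smul (c : A) d (y : N)) }
  have hP : IsPGroup p (Subgroup.zpowers a) := fun c => ⟨1, by
    rw [pow_one]; exact Subtype.ext (hA.2 c)⟩
  have hS : Nat.card S = Nat.card H := by
    have := QuotientGroup.card_preimage_mk H {(QuotientGroup.mk x : N ⧸ H)}
    simpa [Set.ncard, Set.encard, Nat.card] using! this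
  have hdvd : ¬ p ∣ Nat.card S := fun hd =>
    hp.coprime_iff_not_dvd.1 hN.symm ((hS ▸ hd).trans H.card_subgroup_dvd_card)
  obtain ⟨y, hy⟩ := hP.nonempty_fixed_point_of_prime_not_dvd_card S hdvd
  exact ⟨y, y.2, congrArg Subtype.val (hy ⟨a, Subgroup.mem_zpowers a⟩)⟩

theorem centralizerSpan_eq_top_of_quotient {p : ℕ} (hp : p.Prime) {A N : Type*} [Group A]
    [Group N] [Finite N] [MulDistribMulAction A N] (hN : (Nat.card N).Coprime p)
    (hA : IsElementaryAbelian p A) {H : Subgroup N} [H.Normal]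
    (h : ∀ (a : A), ∀ x ∈ H, a • x ∈ H)
    (hH : @centralizerSpan A H _ _ (invariantSubgroupAction H h) = ⊤)
    (hQ : @centralizerSpan A (N ⧸ H) _ _ (quotientInvariantAction H h) = ⊤) :
    centralizerSpan A N = ⊤ := by
  have hHle := le_centralizerSpan_of_invariant h hH
  let := quotientInvariantAction H h
  have hle : centralizerSpan A (N ⧸ H) ≤ (centralizerSpan A N).map (QuotientGroup.mk' H) := by
    refine (Subgroup.closure_le _).2 fun x ⟨a, ha, hx⟩ => ?_
    obtain ⟨x, rfl⟩ := QuotientGroup.mk_surjective x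
    obtain ⟨y, hy, hay⟩ := exists_smul_eq_of_quotient hp hN hA h hx
    exact ⟨y, mem_centralizerSpan ha hay, hy⟩
  refine (Subgroup.eq_top_iff' _).2 fun x => ?_
  obtain ⟨y, hy, hyx⟩ := hle (hQ ▸ Subgroup.mem_top (QuotientGroup.mk x : N ⧸ H))
  have := hHle (QuotientGroup.eq.1 hyx)
  exact (Subgroup.mul_mem_cancel_left _ (inv_mem hy)).1 this

/-- A noncyclic elementary abelian group acting coprimely on `N`: the centralizers of its
nontrivial elements generate `N`. -/
theorem centralizerSpan_eq_top {p : ℕ} (hp : p.Prime) {A : Type*} [Group A] [Finite A]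
    (hA : IsElementaryAbelian p A) {a b : A} (hb : b ≠ 1) (hab : a ∉ Subgroup.zpowers b)
    {N : Type*} [Group N] [Finite N] [MulDistribMulAction A N] (hN : (Nat.card N).Coprime p) :
    centralizerSpan A N = ⊤ := by
  induction hn : Nat.card N using Nat.strong_induction_on generalizing N with
  | _ n ih =>
  subst hn
  have : Fact p.Prime := ⟨hp⟩
  have hsub {H : Subgroup N} (hH : H ≠ ⊤) (h : ∀ (a : A), ∀ x ∈ H, a • x ∈ H) :
      @centralizerSpan A H _ _ (invariantSubgroupAction H h) = ⊤ :=
    @ih (Nat.card H) (lt_of_le_of_ne (Subgroup.card_le_card_group H)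
        fun he => hH (Subgroup.eq_top_of_card_eq _ he)) H _ _ (invariantSubgroupAction H h)
      (hN.coprime_dvd_left H.card_subgroup_dvd_card) rfl
  by_contra hne
  obtain ⟨q, hq, hqd⟩ := Nat.exists_prime_and_dvd (mt Subgroup.index_eq_one.1 hne)
  have : Fact q.Prime := ⟨hq⟩
  have hP : IsPGroup p A := fun a => ⟨1, by rw [pow_one]; exact hA.2 a⟩
  obtain ⟨Q, hQ⟩ := hP.nonempty_fixed_point_of_prime_not_dvd_card (Sylow q N) fun hd => by
    obtain ⟨Q⟩ : Nonempty (Sylow q N) := inferInstance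
    exact hp.coprime_iff_not_dvd.1 hN.symm
      ((hd.trans Q.card_dvd_index).trans (Subgroup.index_dvd_card _))
  have hQinv (a : A) (x : N) (hx : x ∈ (Q : Subgroup N)) : a • x ∈ (Q : Subgroup N) := by
    have h1 : a • (Q : Subgroup N) = Q := congrArg Sylow.toSubgroup (hQ a)
    rw [← h1]
    exact Subgroup.smul_mem_pointwise_smul _ _ _ hx
  by_cases hQt : (Q : Subgroup N) = ⊤
  · have hNq : IsPGroup q N := fun x => by
      obtain ⟨k, hk⟩ := Q.2 ⟨x, hQt ▸ Subgroup.mem_top x⟩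
      exact ⟨k, congrArg Subtype.val hk⟩
    have : Nontrivial N := by
      by_contra hN1
      rw [not_nontrivial_iff_subsingleton] at hN1
      exact hne (Subsingleton.elim _ _)
    have hZ := hNq.center_nontrivial
    by_cases hZt : Subgroup.center N = ⊤
    · let : CommGroup N := { ‹Group N› with
        mul_comm x y := (Subgroup.mem_center_iff.1 (hZt ▸ Subgroup.mem_top y) x) }
      exact hne (centralizerSpan_eq_top_of_commGroup hp hN hA hb hab)
    · have hZinv (a : A) (x : N) (hx : x ∈ Subgroup.center N) : a • x ∈ Subgroup.center N := by
        have := Subgroup.characteristic_iff_le_comap.1 Subgroup.centerCharacteristic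
          (MulDistribMulAction.toMulEquiv N a) hx
        exact this
      refine hne (centralizerSpan_eq_top_of_quotient hp hN hA hZinv (hsub hZt hZinv) ?_)
      have hdvd := Subgroup.card_quotient_dvd_card (Subgroup.center N)
      refine @ih _ ?_ _ _ _ (quotientInvariantAction _ hZinv) (hN.coprime_dvd_left hdvd) rfl
      rw [Subgroup.card_eq_card_quotient_mul_card_subgroup (Subgroup.center N)]
      exact lt_mul_of_one_lt_right Nat.card_pos (Finite.one_lt_card)
  · exact Q.not_dvd_index (hqd.trans
      (Subgroup.index_dvd_of_le (le_centralizerSpan_of_invariant hQinv (hsub hQt hQinv))))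

theorem segment_subset_geomRealOn {X : Type*} [Preorder X] {S : Set X} {f g : X → ℝ}
    (hf : f ∈ geomRealOn S) (hg : g ∈ geomRealOn S)
    (hfg : IsChain (· ≤ ·) (support f ∪ support g)) : segment ℝ f g ⊆ geomRealOn S := by
  classical
  obtain ⟨hf0, hfS, -, s, hs, hfs⟩ := hf
  obtain ⟨hg0, hgS, -, t, ht, hgt⟩ := hg
  rintro _ ⟨a, b, ha, hb, hab, rfl⟩
  have hsupp : support (a • f + b • g) ⊆ support f ∪ support g :=
    (support_add _ _).trans
      (Set.union_subset_union (support_const_smul_subset a f) (support_const_smul_subset b g))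
  refine ⟨fun x => add_nonneg (mul_nonneg ha (hf0 x)) (mul_nonneg hb (hg0 x)),
    hsupp.trans (Set.union_subset hfS hgS), hfg.mono hsupp, s ∪ t,
    hsupp.trans (by simpa using ⟨hs.trans Set.subset_union_left, ht.trans Set.subset_union_right⟩),
    ?_⟩
  have h1 : ∑ x ∈ s ∪ t, f x = 1 := by
    rw [← hfs]
    refine (Finset.sum_subset Finset.subset_union_left fun x _ hx => ?_).symm
    exact notMem_support.1 fun h => hx (hs h)
  have h2 : ∑ x ∈ s ∪ t, g x = 1 := by
    rw [← hgt]
    refine (Finset.sum_subset Finset.subset_union_right fun x _ hx => ?_).symm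
    exact notMem_support.1 fun h => hx (ht h)
  simp [Finset.sum_add_distrib, ← Finset.mul_sum, h1, h2, hab]

open scoped Classical in
theorem single_mem_geomRealOn {X : Type*} [Preorder X] {S : Set X} {x : X} (hx : x ∈ S) :
    (Pi.single x 1 : X → ℝ) ∈ geomRealOn S := by
  have hsupp : support (Pi.single x 1 : X → ℝ) = {x} := Pi.support_single_of_ne one_ne_zero
  refine ⟨fun y => ?_, by simpa [hsupp] using hx, by rw [hsupp]; exact IsChain.singleton,
    {x}, by simp [hsupp], by simp⟩
  by_cases h : y = x
  · subst h; simp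
  · simp [h]

open scoped Classical in
theorem joinedIn_single_of_le {X : Type*} [Preorder X] {S : Set X} {x y : X} (hx : x ∈ S)
    (hy : y ∈ S) (hxy : x ≤ y) :
    JoinedIn (geomRealOn S) (Pi.single x 1 : X → ℝ) (Pi.single y 1) := by
  refine JoinedIn.of_segment_subset
    (segment_subset_geomRealOn (single_mem_geomRealOn hx) (single_mem_geomRealOn hy) ?_)
  rw [Pi.support_single_of_ne one_ne_zero, Pi.support_single_of_ne one_ne_zero]
  exact IsChain.singleton.insert fun z hz _ => Or.inl (hz ▸ hxy)

open scoped Classical in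
/-- A geometric realization is connected as soon as all vertices can be joined to a given one. -/
theorem connectedSpace_geomRealOn {X : Type*} [Preorder X] {S : Set X} {x₀ : X} (hx₀ : x₀ ∈ S)
    (h : ∀ x ∈ S, JoinedIn (geomRealOn S) (Pi.single x₀ 1 : X → ℝ) (Pi.single x 1)) :
    ConnectedSpace (geomRealOn S) := by
  refine isConnected_iff_connectedSpace.1 (IsPathConnected.isConnected
    ⟨_, single_mem_geomRealOn hx₀, fun {f} hf => ?_⟩)
  obtain ⟨x, hx⟩ : (support f).Nonempty := by
    rw [support_nonempty_iff]
    rintro rfl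
    obtain ⟨-, -, -, s, -, hs⟩ := hf
    simp at hs
  refine (h x (hf.2.1 hx)).trans (JoinedIn.of_segment_subset
    (segment_subset_geomRealOn (single_mem_geomRealOn (hf.2.1 hx)) hf ?_))
  rw [Pi.support_single_of_ne one_ne_zero, Set.union_eq_right.2 (by simpa using hx)]
  exact hf.2.2.1

theorem IsElementaryAbelian.of_injective {p : ℕ} {G H : Type*} [Group G] [Group H]
    (hH : IsElementaryAbelian p H) (f : G →* H) (hf : Injective f) : IsElementaryAbelian p G :=
  ⟨fun a b => hf (by rw [map_mul, map_mul, hH.1]), fun a => hf (by rw [map_pow, hH.2, map_one])⟩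

theorem apSet_of_le {p : ℕ} {G : Type*} [Group G] {H K : Subgroup G} (hH : H ∈ apSet p G)
    (hK : K ≠ ⊥) (hKH : K ≤ H) : K ∈ apSet p G :=
  ⟨hK, hH.2.of_injective (Subgroup.inclusion hKH) (Subgroup.inclusion_injective hKH)⟩

theorem smul_mem_apSet {p : ℕ} {G : Type*} [Group G] {H : Subgroup G} (hH : H ∈ apSet p G)
    (f : MulAut G) : f • H ∈ apSet p G := by
  refine ⟨fun h => hH.1 ?_, hH.2.of_injective (Subgroup.equivSMul f H).symm.toMonoidHom
    (Subgroup.equivSMul f H).symm.injective⟩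
  rw [← inv_smul_smul f H, h, Subgroup.smul_bot]

theorem conj_smul_zpowers_of_commute {G : Type*} [Group G] {g h : G} (hgh : Commute g h) :
    MulAut.conj g • Subgroup.zpowers h = Subgroup.zpowers h := by
  refine (MonoidHom.map_zpowers (MulAut.conj g).toMonoidHom h).trans (congrArg _ ?_)
  simp [hgh.eq]

open scoped Classical in
/-- If `A` is an elementary abelian subgroup and every element of a set `T` centralizes some
nontrivial element of `A`, then `A` can be joined in `A_p(G)` to its conjugates
under the subgroup generated by `T`. -/
theorem joinedIn_conj_of_mem_closure {p : ℕ} {G : Type*} [Group G] {A : Subgroup G}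
    (hA : A ∈ apSet p G) {T : Set G} (hT : ∀ t ∈ T, ∃ a ∈ A, a ≠ 1 ∧ Commute t a) {g : G}
    (hg : g ∈ Subgroup.closure T) :
    JoinedIn (geomRealOn (apSet p G)) (Pi.single A 1 : Subgroup G → ℝ)
      (Pi.single (MulAut.conj g • A) 1) := by
  have key (x t a : G) (ha : a ∈ A) (ha1 : a ≠ 1) (hta : Commute t a) :
      JoinedIn (geomRealOn (apSet p G)) (Pi.single (MulAut.conj x • A) 1 : Subgroup G → ℝ)
        (Pi.single (MulAut.conj (x * t) • A) 1) := by
    have hle := Subgroup.zpowers_le.2 ha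
    have hB : Subgroup.zpowers a ∈ apSet p G :=
      apSet_of_le hA (mt Subgroup.zpowers_eq_bot.1 ha1) hle
    refine (joinedIn_single_of_le (smul_mem_apSet hB _) (smul_mem_apSet hA _)
      (Subgroup.pointwise_smul_le_pointwise_smul_iff.2 hle)).symm.trans
      (joinedIn_single_of_le (smul_mem_apSet hB _) (smul_mem_apSet hA _) ?_)
    rw [map_mul, mul_smul, Subgroup.pointwise_smul_le_pointwise_smul_iff,
      ← conj_smul_zpowers_of_commute hta]
    exact Subgroup.pointwise_smul_le_pointwise_smul_iff.2 hle
  induction hg using Subgroup.closure_induction_right with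
  | one => simpa using JoinedIn.refl (single_mem_geomRealOn hA)
  | mul_right x _ t ht ih =>
    obtain ⟨a, ha, ha1, hta⟩ := hT t ht
    exact ih.trans (key x t a ha ha1 hta)
  | mul_inv_cancel x _ t ht ih =>
    obtain ⟨a, ha, ha1, hta⟩ := hT t ht
    exact ih.trans (key x t⁻¹ a ha ha1 hta.inv_left)

/-- If `N` is a finite group of order prime to `p` and `A` is an
elementary abelian `p`-group of rank at least 2 acting on `N`, then `A_p(N ⋊ A)` is
connected. -/
theorem stmt9 (p : ℕ) (hp : p.Prime) (N : Type) [Group N] [Finite N]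
    (hN : ¬ p ∣ Nat.card N) (A : Type) [Group A] [Finite A]
    (hA : IsElementaryAbelian p A) (r : ℕ) (hr : 2 ≤ r) (hcard : Nat.card A = p ^ r)
    (φ : A →* MulAut N) :
    ConnectedSpace ↥(geomRealOn (apSet p (N ⋊[φ] A))) := by
  have : Fact p.Prime := ⟨hp⟩
  have hcop : (Nat.card N).Coprime p := (hp.coprime_iff_not_dvd.2 hN).symm
  have : Finite (N ⋊[φ] A) := Finite.of_equiv _ SemidirectProduct.equivProd.symm
  let R : Subgroup (N ⋊[φ] A) := (SemidirectProduct.inr : A →* N ⋊[φ] A).range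
  have : Nontrivial A := Finite.one_lt_card_iff_nontrivial.1
    (hcard ▸ Nat.one_lt_pow (by omega) hp.one_lt)
  obtain ⟨b, hb⟩ := exists_ne (1 : A)
  obtain ⟨a, hab⟩ : ∃ a, a ∉ Subgroup.zpowers b := by
    by_contra! h
    have h1 : Nat.card (Subgroup.zpowers b) = p := by
      rw [Nat.card_zpowers]
      exact orderOf_eq_prime (hA.2 b) hb
    rw [(Subgroup.eq_top_iff' _).2 h, Subgroup.card_top, hcard] at h1
    exact absurd (Nat.pow_right_injective hp.two_le (h1.trans (pow_one p).symm)) (by omega)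
  let e : A ≃* R := MonoidHom.ofInjective SemidirectProduct.inr_injective
  have hR : R ∈ apSet p (N ⋊[φ] A) := by
    refine ⟨fun h => hb (SemidirectProduct.inr_injective (φ := φ) ?_),
      hA.of_injective e.symm.toMonoidHom e.symm.injective⟩
    rw [map_one, ← Subgroup.mem_bot, ← h]
    exact ⟨b, rfl⟩
  have hRcard : Nat.card R = p ^ (Nat.card (N ⋊[φ] A)).factorization p := by
    rw [← Nat.card_congr e.toEquiv, SemidirectProduct.card, hcard,
      Nat.factorization_mul Nat.card_pos.ne' (pow_pos hp.pos r).ne', Finsupp.add_apply,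
      Nat.factorization_eq_zero_of_not_dvd hN, hp.factorization_pow]
    simp
  refine connectedSpace_geomRealOn hR fun H hH => ?_
  have hHp : IsPGroup p H := fun x => ⟨1, by rw [pow_one]; exact hH.2.2 x⟩
  obtain ⟨Q, hHQ⟩ := hHp.exists_le_sylow
  obtain ⟨g, rfl⟩ := MulAction.exists_smul_eq (N ⋊[φ] A) (Sylow.ofCard R hRcard) Q
  rw [Sylow.coe_subgroup_smul, Sylow.coe_ofCard] at hHQ
  refine JoinedIn.trans ?_ (joinedIn_single_of_le hH (smul_mem_apSet hR _) hHQ).symm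
  let := MulDistribMulAction.compHom N φ
  let T : Set (N ⋊[φ] A) := {t | ∃ a ∈ R, a ≠ 1 ∧ Commute t a}
  refine joinedIn_conj_of_mem_closure (T := T) hR (fun t ht => ht) ?_
  have hinr (c : A) : SemidirectProduct.inr c ∈ Subgroup.closure T :=
    Subgroup.subset_closure ⟨SemidirectProduct.inr b, ⟨b, rfl⟩,
      fun h => hb (SemidirectProduct.inr_injective (h.trans (map_one _).symm)),
      (show Commute c b from hA.1 c b).map _⟩
  have hinl : centralizerSpan A N ≤ (Subgroup.closure T).comap SemidirectProduct.inl := by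
    refine (Subgroup.closure_le _).2 fun x ⟨c, hc, hx⟩ => Subgroup.subset_closure
      ⟨SemidirectProduct.inr c, ⟨c, rfl⟩,
        fun h => hc (SemidirectProduct.inr_injective (h.trans (map_one _).symm)), ?_⟩
    have h1 := SemidirectProduct.inl_aut (φ := φ) c x
    rw [show φ c x = x from hx, map_inv, eq_mul_inv_iff_mul_eq] at h1
    exact h1
  rw [centralizerSpan_eq_top hp hA hb hab hcop] at hinl
  rw [← SemidirectProduct.inl_left_mul_inr_right g]
  exact mul_mem (hinl (Subgroup.mem_top g.left)) (hinr g.right)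
end
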